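/- There exists a constant c > 0 such that for all sufficiently large x, the number of integers n ≤ x such that φ(n) is 2-dense is at least c·x. -/

import Mathlib

open scoped Classical

open Filter

/-- `n` is `u`-dense. -/
def UDense (n : ℕ) (u : ℝ) : Prop :=
  ∀ y : ℝ, 1 ≤ y → y < (n : ℝ) → ∃ d : ℕ, d ∣ n ∧ y < (d : ℝ) ∧ (d : ℝ) ≤ u * y

theorem uDense_one (u : ℝ) : UDense 1 u := by
  intro y hy hy'
  norm_num at hy'
  linarith

theorem UDense.mul_of_le {D k : ℕ} (hD : UDense D 2) (hk : k ≤ 2 * D) : UDense (D * k) 2 := by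
  intro y hy hy'
  rcases Nat.eq_zero_or_pos k with rfl | hk0
  · norm_num at hy'
    linarith
  have hk1 : (0 : ℝ) < k := by exact_mod_cast hk0
  have hkr : (k : ℝ) ≤ 2 * D := by exact_mod_cast hk
  rcases lt_or_ge y (D : ℝ) with h | h
  · obtain ⟨d, hd, h1, h2⟩ := hD y hy h
    exact ⟨d, hd.mul_right k, h1, h2⟩
  rcases lt_or_ge y (k : ℝ) with h' | h'
  · exact ⟨k, dvd_mul_left k D, h', by linarith⟩
  · obtain ⟨d, hd, h1, h2⟩ := hD (y / k) (by rwa [le_div_iff₀ hk1, one_mul])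
      (by rw [div_lt_iff₀ hk1]; push_cast at hy'; exact hy')
    refine ⟨d * k, Nat.mul_dvd_mul_right hd k, ?_, ?_⟩
    · push_cast
      rwa [div_lt_iff₀ hk1] at h1
    · push_cast
      calc (d : ℝ) * k ≤ 2 * (y / k) * k := by gcongr
        _ = 2 * y := by field_simp

theorem uDense_two_pow (L : ℕ) : UDense (2 ^ L) 2 := by
  induction L with
  | zero => simpa using uDense_one 2
  | succ L ih =>
    rw [pow_succ]
    exact ih.mul_of_le (by have := Nat.one_le_two_pow (n := L); omega)

theorem UDense.mul_prod {ι : Type*} {D : ℕ} (hD : UDense D 2) (s : Finset ι) (k : ι → ℕ)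
    (hk : ∀ i ∈ s, 1 ≤ k i ∧ k i ≤ 2 * D) : UDense (D * ∏ i ∈ s, k i) 2 := by
  induction s using Finset.induction_on with
  | empty => simpa using hD
  | insert i s hi ih =>
    have h1 : 1 ≤ ∏ i ∈ s, k i :=
      Finset.one_le_prod' fun j hj => (hk j (Finset.mem_insert_of_mem hj)).1
    rw [Finset.prod_insert hi, mul_comm (k i), ← mul_assoc]
    refine (ih fun j hj => hk j (Finset.mem_insert_of_mem hj)).mul_of_le ?_
    have h2 := (hk i (Finset.mem_insert_self i s)).2
    have h3 : D * 1 ≤ D * ∏ i ∈ s, k i := Nat.mul_le_mul_left D h1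
    omega

/-- Multiplying `N` by a prime `p` multiplies `φ(N)` by `p` or by `p - 1`. -/
theorem Nat.totient_mul_prime {N p : ℕ} (hp : p.Prime) :
    ∃ k, Nat.totient (N * p) = Nat.totient N * k ∧ p - 1 ≤ k ∧ k ≤ p := by
  by_cases h : p ∣ N
  · refine ⟨p, ?_, by omega, le_rfl⟩
    rw [mul_comm N p, Nat.totient_mul_of_prime_of_dvd hp h, mul_comm]
  · refine ⟨p - 1, ?_, le_rfl, by omega⟩
    rw [mul_comm N p, Nat.totient_mul_of_prime_of_not_dvd hp h, mul_comm]

theorem uDense_totient_of_dvd {N D n : ℕ} (hD : UDense D 2) (hDN : D ∣ Nat.totient N)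
    (hNn : N ∣ n) (hn : 0 < n) (hsq : n ≤ D * D) : UDense (Nat.totient n) 2 := by
  obtain ⟨k, hk⟩ := hDN.trans (Nat.totient_dvd_of_dvd hNn)
  rw [hk]
  refine hD.mul_of_le ?_
  have h1 : D * k ≤ D * D := hk ▸ (Nat.totient_le n).trans hsq
  have hD0 : 0 < D := by
    rcases Nat.eq_zero_or_pos D with rfl | h
    · omega
    · exact h
  have := Nat.le_of_mul_le_mul_left h1 hD0
  omega

/-- A large dense divisor of `φ(N)` grows when `N` is multiplied by primes not exceeding it. -/
theorem exists_uDense_dvd_totient_mul_prod {r : ℕ} (v : Fin r → ℕ) {N B : ℕ} {D : ℕ}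
    (hD : UDense D 2) (hDN : D ∣ Nat.totient N) (hD0 : 0 < D)
    (hv : ∀ i, (v i).Prime ∧ B < v i ∧ v i ≤ D) :
    ∃ D', UDense D' 2 ∧ D' ∣ Nat.totient (N * ∏ i, v i) ∧ D * B ^ r ≤ D' := by
  induction r with
  | zero => exact ⟨D, hD, by simpa using hDN, by simp⟩
  | succ r ih =>
    obtain ⟨D', h1, h2, h3⟩ := ih (fun i => v i.castSucc) (fun i => hv i.castSucc)
    obtain ⟨hp, hB, hle⟩ := hv (Fin.last r)
    obtain ⟨k, hk, hk1, hk2⟩ := Nat.totient_mul_prime (N := N * ∏ i : Fin r, v i.castSucc) hp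
    rcases Nat.eq_zero_or_pos B with rfl | hB0
    · exact ⟨D, hD, hDN.trans (Nat.totient_dvd_of_dvd (dvd_mul_right _ _)), by simp⟩
    have h4 : D ≤ D' := (Nat.le_mul_of_pos_right D (pow_pos hB0 r)).trans h3
    refine ⟨D' * k, h1.mul_of_le (by omega), ?_, ?_⟩
    · rw [Fin.prod_univ_castSucc, ← mul_assoc, hk]
      exact Nat.mul_dvd_mul_right h2 k
    · calc D * B ^ (r + 1) = D * B ^ r * B := by ring
        _ ≤ D' * k := Nat.mul_le_mul h3 (by omega)

theorem Nat.log_factorial_eq_sum (n : ℕ) :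
    Real.log (n.factorial) = ∑ p ∈ Nat.primesLE n, (n.factorial.factorization p) * Real.log p := by
  conv_lhs => rw [← Nat.prod_factorization_pow_eq_self (Nat.factorial_ne_zero n)]
  rw [Nat.prod_factorization_eq_prod_primeFactors, Nat.cast_prod, Real.log_prod]
  · have : n.factorial.primeFactors = Nat.primesLE n := by
      ext p
      rw [Nat.mem_primeFactors, Nat.mem_primesLE]
      constructor
      · rintro ⟨hp, hd, -⟩
        exact ⟨(hp.dvd_factorial).1 hd, hp⟩
      · rintro ⟨hd, hp⟩
        exact ⟨hp, (hp.dvd_factorial).2 hd, Nat.factorial_ne_zero n⟩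
    rw [this]
    refine Finset.sum_congr rfl fun p _ => ?_
    push_cast
    rw [Real.log_pow]
  · intro p hp
    have := (Nat.prime_of_mem_primeFactors hp).pos
    positivity

theorem summable_log_div_mul_sub_one :
    Summable fun k : ℕ => Real.log k / (k * (k - 1) : ℝ) := by
  have h : Summable fun k : ℕ => 4 * (1 / (k : ℝ) ^ (3 / 2 : ℝ)) :=
    (Real.summable_one_div_nat_rpow.2 (by norm_num)).mul_left 4
  refine Summable.of_nonneg_of_le (fun k => ?_) (fun k => ?_) h
  · rcases Nat.lt_or_ge k 2 with hk | hk
    · interval_cases k <;> simp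
    · have : (2 : ℝ) ≤ k := by exact_mod_cast hk
      have := Real.log_nonneg (by linarith : (1 : ℝ) ≤ k)
      have : (0 : ℝ) ≤ k - 1 := by linarith
      positivity
  · rcases Nat.lt_or_ge k 2 with hk | hk
    · interval_cases k <;> simp
    · have hk' : (2 : ℝ) ≤ k := by exact_mod_cast hk
      have h1 : Real.log k ≤ (k : ℝ) ^ (1 / 2 : ℝ) / (1 / 2) :=
        Real.log_le_rpow_div (by linarith) (by norm_num)
      have h2 : (k : ℝ) ^ (3 / 2 : ℝ) * (k : ℝ) ^ (1 / 2 : ℝ) = k ^ 2 := by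
        rw [← Real.rpow_add (by linarith), ← Real.rpow_natCast]
        norm_num
      have h3 : (0 : ℝ) < (k : ℝ) ^ (3 / 2 : ℝ) := by positivity
      have h4 : (0 : ℝ) < k * (k - 1) := by nlinarith
      rw [mul_one_div, div_le_div_iff₀ h4 h3]
      calc Real.log k * (k : ℝ) ^ (3 / 2 : ℝ)
          ≤ (k : ℝ) ^ (1 / 2 : ℝ) / (1 / 2) * (k : ℝ) ^ (3 / 2 : ℝ) := by gcongr
        _ = 2 * (k : ℝ) ^ 2 := by rw [← h2]; ring
        _ ≤ 4 * (k * (k - 1)) := by nlinarith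

/-- The first theorem of Mertens. -/
theorem exists_abs_sum_log_div_sub_log_le :
    ∃ C : ℝ, 0 ≤ C ∧ ∀ n : ℕ, 1 ≤ n →
      |∑ p ∈ Nat.primesLE n, Real.log p / p - Real.log n| ≤ C := by
  set K := ∑' k : ℕ, Real.log k / (k * (k - 1) : ℝ) with hK
  have hnn : ∀ k : ℕ, 0 ≤ Real.log k / (k * (k - 1) : ℝ) := by
    intro k
    rcases Nat.lt_or_ge k 2 with hk | hk
    · interval_cases k <;> simp
    · have : (2 : ℝ) ≤ k := by exact_mod_cast hk
      have := Real.log_nonneg (by linarith : (1 : ℝ) ≤ k)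
      have : (0 : ℝ) ≤ k - 1 := by linarith
      positivity
  have hK0 : 0 ≤ K := tsum_nonneg hnn
  refine ⟨1 + K + Real.log 4, by positivity, fun n hn => ?_⟩
  have hn0 : (0 : ℝ) < n := by exact_mod_cast hn
  have hfac := Nat.log_factorial_eq_sum n
  have hl4 : 0 ≤ Real.log 4 := by positivity
  rw [abs_le]
  constructor
  · have h1 : n * Real.log n - n ≤ Real.log n.factorial := by
      have := Stirling.le_log_factorial_stirling (n := n) (by omega)
      have h2 : 0 ≤ Real.log n := Real.log_natCast_nonneg n
      have h3 : 0 ≤ Real.log (2 * Real.pi) := Real.log_nonneg (by linarith [Real.pi_gt_three])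
      linarith
    have h2 : Real.log n.factorial ≤
        ∑ p ∈ Nat.primesLE n, n * (Real.log p / p + Real.log p / (p * (p - 1) : ℝ)) := by
      rw [hfac]
      refine Finset.sum_le_sum fun p hp => ?_
      have hpp := (Nat.mem_primesLE.1 hp).2
      have := Fact.mk hpp
      have hp2 : (2 : ℝ) ≤ p := by exact_mod_cast hpp.two_le
      have h3 := sub_one_mul_padicValNat_factorial (p := p) n
      have h4 : (p - 1) * n.factorial.factorization p ≤ n := by
        rw [Nat.factorization_def _ hpp, h3]; omega
      have h5 : ((p : ℝ) - 1) * n.factorial.factorization p ≤ n := by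
        have : (((p - 1) * n.factorial.factorization p : ℕ) : ℝ) ≤ n := by exact_mod_cast h4
        rwa [Nat.cast_mul, Nat.cast_sub hpp.one_lt.le, Nat.cast_one] at this
      have h6 : (0 : ℝ) < p - 1 := by linarith
      have h7 : (n.factorial.factorization p : ℝ) ≤ n / (p - 1) := by
        rw [le_div_iff₀ h6]; linarith
      calc (n.factorial.factorization p : ℝ) * Real.log p ≤ n / (p - 1) * Real.log p :=
            mul_le_mul_of_nonneg_right h7 (Real.log_natCast_nonneg p)
        _ = _ := by field_simp; ring
    have h3 : ∑ p ∈ Nat.primesLE n, Real.log p / (p * (p - 1) : ℝ) ≤ K :=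
      summable_log_div_mul_sub_one.sum_le_tsum _ fun k _ => hnn k
    rw [← Finset.mul_sum, Finset.sum_add_distrib] at h2
    have h4 : n * (Real.log n - 1) ≤
        n * (∑ p ∈ Nat.primesLE n, Real.log p / p +
          ∑ p ∈ Nat.primesLE n, Real.log p / (p * (p - 1) : ℝ)) := by linarith
    have h5 := le_of_mul_le_mul_left h4 hn0
    linarith
  · have h1 : Real.log n.factorial ≤ n * Real.log n := by
      rw [← Real.log_pow]
      refine Real.log_le_log (by positivity) ?_
      exact_mod_cast Nat.factorial_le_pow n
    have h2 : ∑ p ∈ Nat.primesLE n, (n * (Real.log p / p) - Real.log p) ≤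
        Real.log n.factorial := by
      rw [hfac]
      refine Finset.sum_le_sum fun p hp => ?_
      have hpp := (Nat.mem_primesLE.1 hp).2
      have hp0 : (0 : ℝ) < p := by exact_mod_cast hpp.pos
      have h3 : n / p ≤ n.factorial.factorization p := by
        rw [← hpp.pow_dvd_iff_le_factorization (Nat.factorial_ne_zero n)]
        have := Nat.prod_factorial_dvd_factorial_sum (Finset.range (n / p)) fun _ => p
        simp only [Finset.prod_const, Finset.card_range, Finset.sum_const, smul_eq_mul] at this
        exact (pow_dvd_pow_of_dvd (Nat.dvd_factorial hpp.pos le_rfl) _).trans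
          (this.trans (Nat.factorial_dvd_factorial (Nat.div_mul_le_self n p)))
      have h4 : (n : ℝ) / p - 1 ≤ (n / p : ℕ) := by
        rw [sub_le_iff_le_add, div_le_iff₀ hp0]
        have := Nat.lt_div_mul_add (a := n) hpp.pos
        have : n ≤ (n / p + 1) * p := by nlinarith
        exact_mod_cast this
      have h5 : (n : ℝ) / p - 1 ≤ n.factorial.factorization p :=
        h4.trans (by exact_mod_cast h3)
      calc n * (Real.log p / p) - Real.log p = ((n : ℝ) / p - 1) * Real.log p := by ring
        _ ≤ _ := mul_le_mul_of_nonneg_right h5 (Real.log_natCast_nonneg p)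
    rw [Finset.sum_sub_distrib, ← Finset.mul_sum, ← Chebyshev.theta_eq_sum_primesLE_log] at h2
    have h3 := Chebyshev.theta_le_log4_mul_x (x := n) hn0.le
    have h4 : n * (∑ p ∈ Nat.primesLE n, Real.log p / p) ≤ n * (Real.log n + Real.log 4) := by
      linarith
    have h5 := le_of_mul_le_mul_left h4 hn0
    linarith

/-- The primes in the interval `(2 ^ a, 2 ^ b]`. -/
def dyadicPrimes (a b : ℕ) : Finset ℕ := (Finset.Ioc (2 ^ a) (2 ^ b)).filter Nat.Prime

theorem mem_dyadicPrimes {a b p : ℕ} :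
    p ∈ dyadicPrimes a b ↔ (2 ^ a < p ∧ p ≤ 2 ^ b) ∧ p.Prime := by
  simp [dyadicPrimes]

theorem exists_sum_log_div_dyadicPrimes :
    ∃ C : ℕ, ∀ a b : ℕ, a ≤ b →
      ((b : ℝ) - a - C) * Real.log 2 ≤ ∑ p ∈ dyadicPrimes a b, Real.log p / p ∧
      ∑ p ∈ dyadicPrimes a b, Real.log p / p ≤ ((b : ℝ) - a + C) * Real.log 2 := by
  obtain ⟨C, hC0, hC⟩ := exists_abs_sum_log_div_sub_log_le
  obtain ⟨C', hC'⟩ := exists_nat_ge (2 * C / Real.log 2)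
  refine ⟨C', fun a b hab => ?_⟩
  have hl : 0 < Real.log 2 := Real.log_pos (by norm_num)
  rw [div_le_iff₀ hl] at hC'
  have hsplit : ∑ p ∈ dyadicPrimes a b, Real.log p / p =
      ∑ p ∈ Nat.primesLE (2 ^ b), Real.log p / p - ∑ p ∈ Nat.primesLE (2 ^ a), Real.log p / p := by
    rw [eq_sub_iff_add_eq, add_comm, ← Finset.sum_union]
    · congr 1
      ext p
      have : 2 ^ a ≤ 2 ^ b := Nat.pow_le_pow_right (by norm_num) hab
      simp only [Finset.mem_union, Nat.mem_primesLE, mem_dyadicPrimes]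
      constructor
      · rintro (⟨h1, h2⟩ | ⟨⟨h1, h2⟩, h3⟩)
        · exact ⟨by omega, h2⟩
        · exact ⟨h2, h3⟩
      · rintro ⟨h1, h2⟩
        rcases Nat.lt_or_ge (2 ^ a) p with h | h
        · exact Or.inr ⟨⟨h, h1⟩, h2⟩
        · exact Or.inl ⟨h, h2⟩
    · rw [Finset.disjoint_left]
      intro p h1 h2
      have := (Nat.mem_primesLE.1 h1).1
      have := (mem_dyadicPrimes.1 h2).1.1
      omega
  have h1 := abs_le.1 (hC (2 ^ a) Nat.one_le_two_pow)
  have h2 := abs_le.1 (hC (2 ^ b) Nat.one_le_two_pow)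
  push_cast at h1 h2
  rw [Real.log_pow] at h1 h2
  rw [hsplit]
  constructor <;> linarith [h1.1, h1.2, h2.1, h2.2]

theorem exists_sum_inv_dyadicPrimes_ge :
    ∃ C : ℕ, ∀ a b : ℕ, a ≤ b →
      (b : ℝ) - a - C ≤ b * ∑ p ∈ dyadicPrimes a b, (1 : ℝ) / p := by
  obtain ⟨C, hC⟩ := exists_sum_log_div_dyadicPrimes
  refine ⟨C, fun a b hab => ?_⟩
  have hl : 0 < Real.log 2 := Real.log_pos (by norm_num)
  have h1 : ∑ p ∈ dyadicPrimes a b, Real.log p / p ≤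
      ∑ p ∈ dyadicPrimes a b, b * Real.log 2 * ((1 : ℝ) / p) := by
    refine Finset.sum_le_sum fun p hp => ?_
    obtain ⟨⟨h1, h2⟩, h3⟩ := mem_dyadicPrimes.1 hp
    have h3' : (0 : ℝ) < p := by exact_mod_cast h3.pos
    have : Real.log p ≤ b * Real.log 2 := by
      rw [← Real.log_pow]
      exact Real.log_le_log h3' (by exact_mod_cast h2)
    rw [mul_one_div]
    gcongr
  rw [← Finset.mul_sum] at h1
  have h2 := (hC a b hab).1.trans h1
  refine le_of_mul_le_mul_right ?_ hl
  linarith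

theorem sum_powerset_prod_mul_sum {ι : Type*} (P : Finset ι) (a t : ι → ℝ)
    (ha : ∀ i ∈ P, 0 ≤ a i) :
    ∑ S ∈ P.powerset, (∏ i ∈ S, a i) * ∑ i ∈ S, t i =
      (∏ i ∈ P, (1 + a i)) * ∑ i ∈ P, t i * (a i / (1 + a i)) := by
  induction P using Finset.induction_on with
  | empty => simp
  | insert j P hj ih =>
    have ih' := ih fun i hi => ha i (Finset.mem_insert_of_mem hi)
    have hj1 : 1 + a j ≠ 0 := by have := ha j (Finset.mem_insert_self j P); positivity
    have h1 : ∀ S ∈ P.powerset, (∏ i ∈ insert j S, a i) * ∑ i ∈ insert j S, t i =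
        a j * t j * (∏ i ∈ S, a i) + a j * ((∏ i ∈ S, a i) * ∑ i ∈ S, t i) := by
      intro S hS
      have : j ∉ S := fun h => hj (Finset.mem_powerset.1 hS h)
      rw [Finset.prod_insert this, Finset.sum_insert this]
      ring
    rw [Finset.sum_powerset_insert hj, Finset.sum_congr rfl h1, Finset.sum_add_distrib,
      ← Finset.mul_sum, ← Finset.mul_sum, ih', ← Finset.prod_one_add, Finset.prod_insert hj,
      Finset.sum_insert hj]
    field_simp
    ring

/-- The Markov inequality for a random subset of `P`. -/
theorem mul_sum_filter_powerset_le {ι : Type*} (P : Finset ι) (a t : ι → ℝ) (T : ℝ)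
    (ha : ∀ i ∈ P, 0 ≤ a i) (ht : ∀ i ∈ P, 0 ≤ t i) :
    T * ∑ S ∈ P.powerset with T < ∑ i ∈ S, t i, ∏ i ∈ S, a i ≤
      (∏ i ∈ P, (1 + a i)) * ∑ i ∈ P, t i * (a i / (1 + a i)) := by
  rw [← sum_powerset_prod_mul_sum P a t ha, Finset.mul_sum]
  have hnn : ∀ S ∈ P.powerset, 0 ≤ ∏ i ∈ S, a i := fun S hS =>
    Finset.prod_nonneg fun i hi => ha i (Finset.mem_powerset.1 hS hi)
  calc ∑ S ∈ P.powerset with T < ∑ i ∈ S, t i, T * ∏ i ∈ S, a i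
      ≤ ∑ S ∈ P.powerset with T < ∑ i ∈ S, t i, (∏ i ∈ S, a i) * ∑ i ∈ S, t i := by
        refine Finset.sum_le_sum fun S hS => ?_
        rw [Finset.mem_filter] at hS
        rw [mul_comm T]
        exact mul_le_mul_of_nonneg_left hS.2.le (hnn S hS.1)
    _ ≤ _ := Finset.sum_le_sum_of_subset_of_nonneg (Finset.filter_subset _ _) fun S hS _ =>
        mul_nonneg (hnn S hS) (Finset.sum_nonneg fun i hi => ht i (Finset.mem_powerset.1 hS hi))

theorem sum_Icc_inv_sq_le_two (n : ℕ) : ∑ k ∈ Finset.Icc 1 n, (1 : ℝ) / (k : ℝ) ^ 2 ≤ 2 := by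
  have h : ∀ n : ℕ, 1 ≤ n → ∑ k ∈ Finset.Icc 1 n, (1 : ℝ) / (k : ℝ) ^ 2 ≤ 2 - 1 / n := by
    intro n hn
    induction n, hn using Nat.le_induction with
    | base => norm_num
    | succ n hn ih =>
      rw [Finset.sum_Icc_succ_top (by omega)]
      have hn' : (1 : ℝ) ≤ n := by exact_mod_cast hn
      have : (1 : ℝ) / ((n + 1 : ℕ) : ℝ) ^ 2 ≤ 1 / n - 1 / ((n + 1 : ℕ) : ℝ) := by
        push_cast
        rw [div_sub_div _ _ (by positivity) (by positivity), div_le_div_iff₀ (by positivity)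
          (by positivity)]
        nlinarith
      linarith
  rcases Nat.eq_zero_or_pos n with rfl | hn
  · simp
  · have : (0 : ℝ) ≤ 1 / n := by positivity
    linarith [h n hn]

/-- A lower bound for the sum of `1 / s` over squarefree `s ≤ Z` free of the primes in `Q`. -/
theorem log_le_two_mul_prod_mul_sum (Z : ℕ) (Q : Finset ℕ) :
    Real.log Z ≤ 2 * (∏ q ∈ Q, (1 + (1 : ℝ) / q)) *
      ∑ S ∈ (Nat.primesLE Z \ Q).powerset with ∏ p ∈ S, p ≤ Z, ∏ p ∈ S, (1 : ℝ) / p := by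
  rcases Nat.eq_zero_or_pos Z with rfl | hZ
  · simp only [Nat.cast_zero, Real.log_zero]
    positivity
  have hdec : ∀ n : ℕ, ∃ k s : ℕ, 0 < n → k ^ 2 * s = n ∧ Squarefree s := by
    intro n
    obtain ⟨s, k, h1, h2⟩ := Nat.sq_mul_squarefree n
    exact ⟨k, s, fun _ => ⟨h1, h2⟩⟩
  choose k s hks using hdec
  set B := (Nat.primesLE Z \ Q).powerset.filter fun S => ∏ p ∈ S, p ≤ Z with hB
  set φ : ℕ → ℕ × Finset ℕ × Finset ℕ :=
    fun n => (k n, (s n).primeFactors ∩ Q, (s n).primeFactors \ Q) with hφ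
  set F : ℕ × Finset ℕ × Finset ℕ → ℝ :=
    fun x => 1 / (x.1 : ℝ) ^ 2 * ((∏ p ∈ x.2.1, (1 : ℝ) / p) * ∏ p ∈ x.2.2, (1 : ℝ) / p) with hF
  have hsplit : ∀ n, 0 < n → ((∏ p ∈ (s n).primeFactors ∩ Q, p) *
      ∏ p ∈ (s n).primeFactors \ Q, p) = s n := by
    intro n hn
    rw [Finset.prod_inter_mul_prod_sdiff, Nat.prod_primeFactors_of_squarefree (hks n hn).2]
  have hinj : Set.InjOn φ (Finset.Icc 1 Z) := by
    intro m hm n hn hmn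
    have hm0 := (Finset.mem_Icc.1 (Finset.mem_coe.1 hm)).1
    have hn0 := (Finset.mem_Icc.1 (Finset.mem_coe.1 hn)).1
    simp only [hφ, Prod.mk.injEq] at hmn
    rw [← (hks m hm0).1, ← (hks n hn0).1, ← hsplit m hm0, ← hsplit n hn0, hmn.1, hmn.2.1, hmn.2.2]
  have hmaps : (Finset.Icc 1 Z).image φ ⊆ Finset.Icc 1 Z ×ˢ Q.powerset ×ˢ B := by
    intro x hx
    obtain ⟨n, hn, rfl⟩ := Finset.mem_image.1 hx
    obtain ⟨hn0, hnZ⟩ := Finset.mem_Icc.1 hn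
    obtain ⟨h1, h2⟩ := hks n hn0
    have hk0 : 0 < k n := Nat.pos_of_ne_zero fun h => by rw [h] at h1; simp at h1; omega
    have hs0 : 0 < s n := Nat.pos_of_ne_zero fun h => by rw [h] at h1; simp at h1; omega
    have hsn : s n ≤ n := by
      calc s n ≤ k n ^ 2 * s n := Nat.le_mul_of_pos_left _ (by positivity)
        _ = n := h1
    have hkn : k n ≤ n := by
      calc k n ≤ k n * (k n * s n) := Nat.le_mul_of_pos_right _ (by positivity)
        _ = k n ^ 2 * s n := by ring
        _ = n := h1
    simp only [hφ, Finset.mem_product, Finset.mem_Icc, Finset.mem_powerset, hB, Finset.mem_filter]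
    refine ⟨⟨hk0, hkn.trans hnZ⟩, Finset.inter_subset_right, ?_, ?_⟩
    · refine Finset.sdiff_subset_sdiff (fun p hp => ?_) le_rfl
      rw [Nat.mem_primesLE]
      exact ⟨(Nat.le_of_dvd hs0 (Nat.dvd_of_mem_primeFactors hp)).trans (hsn.trans hnZ),
        Nat.prime_of_mem_primeFactors hp⟩
    · refine le_trans ?_ (hsn.trans hnZ)
      exact Nat.le_of_dvd hs0 (Dvd.intro_left _ (hsplit n hn0))
  have hval : ∀ n ∈ Finset.Icc 1 Z, (n : ℝ)⁻¹ = F (φ n) := by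
    intro n hn
    have hn0 := (Finset.mem_Icc.1 hn).1
    have h3 : (n : ℝ) = (k n : ℝ) ^ 2 * ((∏ p ∈ (s n).primeFactors ∩ Q, (p : ℝ)) *
        ∏ p ∈ (s n).primeFactors \ Q, (p : ℝ)) := by
      conv_lhs => rw [← (hks n hn0).1, ← hsplit n hn0]
      push_cast
      rfl
    rw [h3]
    simp only [hF, hφ, one_div, Finset.prod_inv_distrib, mul_inv]
  have h1 : Real.log Z ≤ ∑ n ∈ Finset.Icc 1 Z, (n : ℝ)⁻¹ := by
    have h := log_add_one_le_harmonic Z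
    rw [harmonic_eq_sum_Icc] at h
    push_cast at h
    refine le_trans (Real.log_le_log (by exact_mod_cast hZ) (by linarith)) h
  calc Real.log Z ≤ ∑ n ∈ Finset.Icc 1 Z, F (φ n) := by rwa [← Finset.sum_congr rfl hval]
    _ = ∑ x ∈ (Finset.Icc 1 Z).image φ, F x := (Finset.sum_image hinj).symm
    _ ≤ ∑ x ∈ Finset.Icc 1 Z ×ˢ Q.powerset ×ˢ B, F x :=
      Finset.sum_le_sum_of_subset_of_nonneg hmaps fun x _ _ => by simp only [hF]; positivity
    _ = (∑ k ∈ Finset.Icc 1 Z, 1 / (k : ℝ) ^ 2) *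
        ((∑ S ∈ Q.powerset, ∏ p ∈ S, (1 : ℝ) / p) * ∑ S ∈ B, ∏ p ∈ S, (1 : ℝ) / p) := by
      rw [Finset.sum_mul_sum, ← Finset.sum_product', Finset.sum_mul_sum, ← Finset.sum_product']
    _ ≤ 2 * ((∑ S ∈ Q.powerset, ∏ p ∈ S, (1 : ℝ) / p) * ∑ S ∈ B, ∏ p ∈ S, (1 : ℝ) / p) := by
      refine mul_le_mul_of_nonneg_right (sum_Icc_inv_sq_le_two Z) ?_
      positivity
    _ = _ := by rw [← Finset.prod_one_add, mul_assoc]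

theorem sum_filter_subset_neg_one_pow {ι : Type*} {𝓛 : Finset (Finset ι)}
    (hdown : ∀ L ∈ 𝓛, ∀ S ⊆ L, S ∈ 𝓛) (L M : Finset ι) (hM : M ∈ 𝓛) :
    ∑ S ∈ 𝓛 with L ⊆ S ∧ S ⊆ M, (-1 : ℝ) ^ S.card = if L = M then (-1 : ℝ) ^ M.card else 0 := by
  by_cases hLM : L ⊆ M
  · have h1 : (𝓛.filter fun S => L ⊆ S ∧ S ⊆ M) = (M \ L).powerset.image (L ∪ ·) := by
      rw [← Finset.Icc_eq_image_powerset hLM]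
      ext S
      simp only [Finset.mem_filter, Finset.mem_Icc]
      exact ⟨fun h => h.2, fun h => ⟨hdown M hM S h.2, h⟩⟩
    rw [h1, Finset.sum_image]
    · have h2 : ∀ S ∈ (M \ L).powerset, (-1 : ℝ) ^ (L ∪ S).card =
          (-1 : ℝ) ^ L.card * (-1 : ℝ) ^ S.card := by
        intro S hS
        rw [Finset.card_union_of_disjoint, pow_add]
        exact Finset.disjoint_sdiff.mono_right (Finset.mem_powerset.1 hS)
      rw [Finset.sum_congr rfl h2, ← Finset.mul_sum]
      have h3 := Finset.sum_powerset_neg_one_pow_card (x := M \ L)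
      have h4 : ∑ S ∈ (M \ L).powerset, (-1 : ℝ) ^ S.card = if M \ L = ∅ then 1 else 0 := by
        have := congrArg (Int.cast : ℤ → ℝ) h3
        push_cast at this
        exact this
      rw [h4]
      by_cases h5 : L = M
      · simp [h5]
      · rw [if_neg h5, if_neg, mul_zero]
        rw [Finset.sdiff_eq_empty_iff_subset]
        exact fun h => h5 (hLM.antisymm h)
    · intro S hS T hT h
      have hS' := Finset.mem_powerset.1 (Finset.mem_coe.1 hS)
      have hT' := Finset.mem_powerset.1 (Finset.mem_coe.1 hT)
      simp only at h
      have e : ∀ U ⊆ M \ L, (L ∪ U) \ L = U := fun U hU => by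
        rw [Finset.union_sdiff_left]
        exact Finset.sdiff_eq_self_of_disjoint (Finset.sdiff_disjoint.mono_left hU)
      rw [← e S hS', ← e T hT', h]
  · rw [if_neg (fun h => hLM h.le), Finset.sum_eq_zero]
    intro S hS
    exact absurd ((Finset.mem_filter.1 hS).2.1.trans (Finset.mem_filter.1 hS).2.2) hLM

/-- The upper bound sieve of Selberg. -/
theorem card_sifted_le {ι α : Type*} (P : Finset ι) (𝒜 : Finset α) (E : ι → α → Prop)
    (ν : ι → ℝ) (hν : ∀ p ∈ P, 0 < ν p ∧ ν p < 1) (X : ℝ) (r : Finset ι → ℝ)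
    (hr : ∀ S ⊆ P, |((𝒜.filter fun a => ∀ p ∈ S, E p a).card : ℝ) - X * ∏ p ∈ S, ν p| ≤ r S)
    (𝓛 : Finset (Finset ι)) (hP : ∀ L ∈ 𝓛, L ⊆ P) (hdown : ∀ L ∈ 𝓛, ∀ S ⊆ L, S ∈ 𝓛)
    (h0 : ∅ ∈ 𝓛) :
    ((𝒜.filter fun a => ∀ p ∈ P, ¬ E p a).card : ℝ) ≤
      X / (∑ L ∈ 𝓛, ∏ p ∈ L, ν p / (1 - ν p)) +
        ∑ S ∈ 𝓛, ∑ T ∈ 𝓛, (∏ p ∈ S, ν p)⁻¹ * (∏ p ∈ T, ν p)⁻¹ * r (S ∪ T) := by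
  set g : Finset ι → ℝ := fun L => ∏ p ∈ L, ν p / (1 - ν p) with hg
  set n : Finset ι → ℝ := fun L => ∏ p ∈ L, ν p with hn
  set G := ∑ L ∈ 𝓛, g L with hG
  have hgpos : ∀ L ⊆ P, 0 < g L := fun L hL => Finset.prod_pos fun p hp =>
    div_pos (hν p (hL hp)).1 (by linarith [(hν p (hL hp)).2])
  have hnpos : ∀ L ⊆ P, 0 < n L := fun L hL => Finset.prod_pos fun p hp => (hν p (hL hp)).1
  have hGpos : 0 < G := Finset.sum_pos (fun L hL => hgpos L (hP L hL)) ⟨∅, h0⟩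
  set lam : Finset ι → ℝ := fun S =>
    (-1) ^ S.card / (n S * G) * ∑ L ∈ 𝓛 with S ⊆ L, g L with hlam
  have hlam0 : lam ∅ = 1 := by
    simp only [hlam, hn, Finset.card_empty, Finset.prod_empty, Finset.empty_subset,
      Finset.filter_true, pow_zero, one_mul]
    rw [one_div, ← hG, inv_mul_cancel₀ hGpos.ne']
  have hlamle : ∀ S ∈ 𝓛, |lam S| ≤ (n S)⁻¹ := by
    intro S hS
    have h1 := hnpos S (hP S hS)
    have h2 : ∑ L ∈ 𝓛 with S ⊆ L, g L ≤ G :=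
      Finset.sum_le_sum_of_subset_of_nonneg (Finset.filter_subset _ _) fun L hL _ =>
        (hgpos L (hP L hL)).le
    have h3 : 0 ≤ ∑ L ∈ 𝓛 with S ⊆ L, g L := Finset.sum_nonneg fun L hL =>
      (hgpos L (hP L (Finset.mem_filter.1 hL).1)).le
    simp only [hlam]
    rw [abs_mul, abs_div, abs_pow, abs_neg, abs_one, one_pow, abs_of_pos (mul_pos h1 hGpos),
      abs_of_nonneg h3, div_mul_eq_mul_div, one_mul, div_le_iff₀ (mul_pos h1 hGpos),
      inv_mul_cancel_left₀ h1.ne']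
    exact h2
  have hinner : ∀ L ∈ 𝓛, ∑ S ∈ 𝓛 with L ⊆ S, lam S * n S = (-1) ^ L.card * g L / G := by
    intro L hL
    have h1 : ∀ S ∈ 𝓛, lam S * n S = ∑ M ∈ 𝓛, if S ⊆ M then (-1) ^ S.card * g M / G else 0 := by
      intro S hS
      have h1 := hnpos S (hP S hS)
      rw [← Finset.sum_filter]
      simp only [hlam]
      rw [Finset.mul_sum, Finset.sum_mul]
      refine Finset.sum_congr rfl fun M _ => ?_
      field_simp
    rw [Finset.sum_congr rfl fun S hS => h1 S (Finset.mem_filter.1 hS).1, Finset.sum_comm]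
    have h2 : ∀ M ∈ 𝓛, (∑ S ∈ 𝓛 with L ⊆ S, if S ⊆ M then (-1) ^ S.card * g M / G else 0) =
        if L = M then (-1) ^ M.card * g M / G else 0 := by
      intro M hM
      rw [← Finset.sum_filter, Finset.filter_filter]
      have h3 := sum_filter_subset_neg_one_pow hdown L M hM
      rw [← Finset.sum_div, ← Finset.sum_mul, h3]
      split_ifs <;> simp
    rw [Finset.sum_congr rfl h2, Finset.sum_ite_eq, if_pos hL]
  have hnunion : ∀ S ∈ 𝓛, ∀ T ∈ 𝓛, n (S ∪ T) =
      ∑ L ∈ 𝓛, (if L ⊆ S then n S else 0) * (if L ⊆ T then n T else 0) * (g L)⁻¹ := by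
    intro S hS T hT
    have h1 : (n (S ∩ T))⁻¹ = ∑ L ∈ (S ∩ T).powerset, (g L)⁻¹ := by
      simp only [hg, hn, ← Finset.prod_inv_distrib]
      rw [← Finset.prod_one_add]
      refine Finset.prod_congr rfl fun p hp => ?_
      obtain ⟨h1, h2⟩ := hν p (hP S hS (Finset.mem_inter.1 hp).1)
      have h3 : 1 - ν p ≠ 0 := by linarith
      field_simp
      ring
    have h2 : n (S ∪ T) * n (S ∩ T) = n S * n T := Finset.prod_union_inter
    have h3 := hnpos (S ∩ T) (Finset.inter_subset_left.trans (hP S hS))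
    have h4 : 𝓛.filter (fun L => L ⊆ S ∧ L ⊆ T) = (S ∩ T).powerset := by
      ext L
      simp only [Finset.mem_filter, Finset.mem_powerset, Finset.subset_inter_iff]
      exact ⟨fun h => h.2, fun h => ⟨hdown S hS L h.1, h⟩⟩
    calc n (S ∪ T) = n S * n T * (n (S ∩ T))⁻¹ := by
          rw [← h2]; field_simp
      _ = ∑ L ∈ 𝓛 with L ⊆ S ∧ L ⊆ T, n S * n T * (g L)⁻¹ := by
          rw [h1, Finset.mul_sum, h4]
      _ = _ := by
          rw [Finset.sum_filter]
          refine Finset.sum_congr rfl fun L _ => ?_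
          by_cases hLS : L ⊆ S <;> by_cases hLT : L ⊆ T <;> simp [hLS, hLT]
  have hmain : ∑ S ∈ 𝓛, ∑ T ∈ 𝓛, lam S * lam T * n (S ∪ T) = 1 / G := by
    calc ∑ S ∈ 𝓛, ∑ T ∈ 𝓛, lam S * lam T * n (S ∪ T)
        = ∑ S ∈ 𝓛, ∑ T ∈ 𝓛, ∑ L ∈ 𝓛, (if L ⊆ S then lam S * n S else 0) *
            (if L ⊆ T then lam T * n T else 0) * (g L)⁻¹ := by
          refine Finset.sum_congr rfl fun S hS => Finset.sum_congr rfl fun T hT => ?_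
          rw [hnunion S hS T hT, Finset.mul_sum]
          refine Finset.sum_congr rfl fun L _ => ?_
          by_cases hLS : L ⊆ S <;> by_cases hLT : L ⊆ T <;> simp [hLS, hLT]
          ring
      _ = ∑ L ∈ 𝓛, (∑ S ∈ 𝓛 with L ⊆ S, lam S * n S) ^ 2 * (g L)⁻¹ := by
          rw [Finset.sum_congr rfl fun S _ => Finset.sum_comm, Finset.sum_comm]
          refine Finset.sum_congr rfl fun L _ => ?_
          rw [sq, Finset.sum_filter, Finset.sum_mul_sum, Finset.sum_mul]
          refine Finset.sum_congr rfl fun S _ => ?_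
          rw [Finset.sum_mul]
      _ = ∑ L ∈ 𝓛, g L / G ^ 2 := by
          refine Finset.sum_congr rfl fun L hL => ?_
          have h1 := (hgpos L (hP L hL)).ne'
          rw [hinner L hL, div_pow, mul_pow, ← pow_mul, mul_comm L.card 2, pow_mul]
          field_simp
          norm_num
      _ = 1 / G := by
          rw [← Finset.sum_div, ← hG]
          field_simp
  set c : Finset ι → ℝ := fun S => ((𝒜.filter fun a => ∀ p ∈ S, E p a).card : ℝ) with hc
  have hsq : ((𝒜.filter fun a => ∀ p ∈ P, ¬ E p a).card : ℝ) ≤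
      ∑ S ∈ 𝓛, ∑ T ∈ 𝓛, lam S * lam T * c (S ∪ T) := by
    calc ((𝒜.filter fun a => ∀ p ∈ P, ¬ E p a).card : ℝ)
        = ∑ a ∈ 𝒜, if ∀ p ∈ P, ¬ E p a then (1 : ℝ) else 0 := by
          rw [Finset.card_filter]; push_cast; rfl
      _ ≤ ∑ a ∈ 𝒜, (∑ S ∈ 𝓛 with ∀ p ∈ S, E p a, lam S) ^ 2 := by
          refine Finset.sum_le_sum fun a _ => ?_
          split_ifs with h
          · have : 𝓛.filter (fun S => ∀ p ∈ S, E p a) = {∅} := by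
              ext S
              simp only [Finset.mem_filter, Finset.mem_singleton]
              constructor
              · rintro ⟨hS, hE⟩
                by_contra hne
                obtain ⟨p, hp⟩ := Finset.nonempty_of_ne_empty hne
                exact h p (hP S hS hp) (hE p hp)
              · rintro rfl
                exact ⟨h0, by simp⟩
            rw [this, Finset.sum_singleton, hlam0]
            norm_num
          · positivity
      _ = ∑ a ∈ 𝒜, ∑ S ∈ 𝓛, ∑ T ∈ 𝓛, lam S * lam T * if ∀ p ∈ S ∪ T, E p a then 1 else 0 := by
          refine Finset.sum_congr rfl fun a _ => ?_
          rw [sq, Finset.sum_filter, Finset.sum_mul_sum]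
          refine Finset.sum_congr rfl fun S _ => Finset.sum_congr rfl fun T _ => ?_
          have : (∀ p ∈ S ∪ T, E p a) ↔ (∀ p ∈ S, E p a) ∧ ∀ p ∈ T, E p a := by
            simp only [Finset.mem_union]
            exact ⟨fun h => ⟨fun p hp => h p (Or.inl hp), fun p hp => h p (Or.inr hp)⟩,
              fun h p hp => hp.elim (h.1 p) (h.2 p)⟩
          by_cases h1 : ∀ p ∈ S, E p a
          · by_cases h2 : ∀ p ∈ T, E p a
            · rw [if_pos h1, if_pos h2, if_pos (this.2 ⟨h1, h2⟩), mul_one]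
            · rw [if_neg h2, if_neg fun h => h2 (this.1 h).2, mul_zero, mul_zero]
          · rw [if_neg h1, if_neg fun h => h1 (this.1 h).1, zero_mul, mul_zero]
      _ = _ := by
          rw [Finset.sum_comm]
          refine Finset.sum_congr rfl fun S _ => ?_
          rw [Finset.sum_comm]
          refine Finset.sum_congr rfl fun T _ => ?_
          simp only [hc]
          rw [← Finset.mul_sum, Finset.card_filter]
          push_cast
          rfl
  refine hsq.trans ?_
  have hsum : X / G + ∑ S ∈ 𝓛, ∑ T ∈ 𝓛, (n S)⁻¹ * (n T)⁻¹ * r (S ∪ T) =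
      ∑ S ∈ 𝓛, ∑ T ∈ 𝓛, (X * (lam S * lam T * n (S ∪ T)) + (n S)⁻¹ * (n T)⁻¹ * r (S ∪ T)) := by
    simp only [Finset.sum_add_distrib, ← Finset.mul_sum]
    rw [hmain, mul_one_div]
  rw [hsum]
  refine Finset.sum_le_sum fun S hS => Finset.sum_le_sum fun T hT => ?_
  have h1 := hr (S ∪ T) (Finset.union_subset (hP S hS) (hP T hT))
  have h2 : lam S * lam T * (c (S ∪ T) - X * n (S ∪ T)) ≤ (n S)⁻¹ * (n T)⁻¹ * r (S ∪ T) := by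
    refine (le_abs_self _).trans ?_
    rw [abs_mul, abs_mul]
    exact mul_le_mul (mul_le_mul (hlamle S hS) (hlamle T hT) (abs_nonneg _)
      (inv_nonneg.2 (hnpos S (hP S hS)).le)) h1 (abs_nonneg _)
      (mul_nonneg (inv_nonneg.2 (hnpos S (hP S hS)).le) (inv_nonneg.2 (hnpos T (hP T hT)).le))
  linarith

theorem abs_card_filter_modEq_sub_le {r : ℕ} (hr : 0 < r) (M N v : ℕ) :
    |(((Finset.Ioc M (M + N)).filter fun a => a ≡ v [MOD r]).card : ℝ) - N / r| ≤ 1 := by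
  have h := Nat.Ioc_filter_modEq_card M (M + N) hr v
  set A := ⌊(((M + N : ℕ) : ℚ) - v) / r⌋ with hA
  set B := ⌊((M : ℚ) - v) / r⌋ with hB
  have hr' : (0 : ℚ) < r := by exact_mod_cast hr
  have hBA : B ≤ A := by
    apply Int.floor_le_floor
    gcongr
    simp
  have h1 : (((Finset.Ioc M (M + N)).filter fun a => a ≡ v [MOD r]).card : ℤ) = A - B := by
    rw [← max_eq_left (by omega : 0 ≤ A - B)]
    convert h using 1
  have h2 : |(((Finset.Ioc M (M + N)).filter fun a => a ≡ v [MOD r]).card : ℚ) - N / r| ≤ 1 := by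
    have h3 : (((Finset.Ioc M (M + N)).filter fun a => a ≡ v [MOD r]).card : ℚ) = A - B := by
      exact_mod_cast h1
    have e : (((M + N : ℕ) : ℚ) - v) / r = ((M : ℚ) - v) / r + N / r := by
      push_cast; field_simp; ring
    rw [h3, abs_le]
    have a1 := Int.floor_le ((((M + N : ℕ) : ℚ) - v) / r)
    have a2 := Int.lt_floor_add_one ((((M + N : ℕ) : ℚ) - v) / r)
    have b1 := Int.floor_le (((M : ℚ) - v) / r)
    have b2 := Int.lt_floor_add_one (((M : ℚ) - v) / r)
    rw [← hA, e] at a1 a2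
    rw [← hB] at b1 b2
    constructor <;> linarith
  have h3 := (Rat.cast_le (K := ℝ)).2 h2
  push_cast at h3
  exact h3

theorem abs_card_filter_forall_mod_sub_le (S : Finset ℕ) (hS : ∀ p ∈ S, p.Prime)
    (R : ℕ → Finset ℕ) (hR : ∀ p ∈ S, ∀ v ∈ R p, v < p) (M N : ℕ) :
    |(((Finset.Ioc M (M + N)).filter fun a => ∀ p ∈ S, a % p ∈ R p).card : ℝ) -
      N * ∏ p ∈ S, ((R p).card : ℝ) / p| ≤ ∏ p ∈ S, ((R p).card : ℝ) := by
  have hcop : Set.Pairwise (S : Set ℕ) (Function.onFun Nat.Coprime id) := fun p hp q hq hpq =>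
    (Nat.coprime_primes (hS p hp) (hS q hq)).2 hpq
  have hpos : 0 < ∏ p ∈ S, p := Finset.prod_pos fun p hp => (hS p hp).pos
  set 𝒜 := (Finset.Ioc M (M + N)).filter fun a => ∀ p ∈ S, a % p ∈ R p with h𝒜
  have hmaps : ∀ a ∈ 𝒜, (fun p (_ : p ∈ S) => a % p) ∈ S.pi R := fun a ha =>
    Finset.mem_pi.2 fun p hp => (Finset.mem_filter.1 ha).2 p hp
  have hone : ∀ c ∈ S.pi R,
      |((𝒜.filter fun a => (fun p (_ : p ∈ S) => a % p) = c).card : ℝ) -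
        N / ((∏ p ∈ S, p : ℕ) : ℝ)| ≤ 1 := by
    intro c hc
    set f : ℕ → ℕ := fun p => if h : p ∈ S then c p h else 0 with hf
    obtain ⟨z, hz⟩ := Nat.chineseRemainderOfFinset f id S (fun p hp => (hS p hp).ne_zero) hcop
    have hEq : (𝒜.filter fun a => (fun p (_ : p ∈ S) => a % p) = c) =
        (Finset.Ioc M (M + N)).filter fun a => a ≡ z [MOD ∏ p ∈ S, p] := by
      ext a
      rw [Finset.mem_filter, h𝒜, Finset.mem_filter, Finset.mem_filter, and_assoc]
      refine and_congr_right fun _ => ?_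
      have h1 : a ≡ z [MOD ∏ p ∈ S, p] ↔ ∀ p ∈ S, a ≡ z [MOD p] := by
        constructor
        · intro h p hp
          exact h.of_dvd (Finset.dvd_prod_of_mem _ hp)
        · intro h
          rw [Nat.modEq_iff_dvd]
          push_cast
          refine Finset.prod_dvd_of_coprime (fun p hp q hq hpq => ?_) fun p hp =>
            Nat.modEq_iff_dvd.1 (h p hp)
          exact Nat.isCoprime_iff_coprime.2 (hcop hp hq hpq)
      rw [h1]
      have h2 : ∀ p (hp : p ∈ S), a ≡ z [MOD p] ↔ a % p = c p hp := by
        intro p hp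
        have h3 : z ≡ f p [MOD p] := hz p hp
        have h4 : f p = c p hp := dif_pos hp
        have h5 : c p hp < p := hR p hp _ (Finset.mem_pi.1 hc p hp)
        rw [h4] at h3
        constructor
        · intro h
          rw [(h.trans h3 : a % p = c p hp % p), Nat.mod_eq_of_lt h5]
        · intro h
          refine Nat.ModEq.trans ?_ h3.symm
          rw [Nat.ModEq, h, Nat.mod_eq_of_lt h5]
      constructor
      · rintro ⟨_, h⟩ p hp
        exact (h2 p hp).2 (congrFun (congrFun h p) hp)
      · intro h
        have h3 : (fun p (_ : p ∈ S) => a % p) = c := by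
          funext p hp
          exact (h2 p hp).1 (h p hp)
        refine ⟨fun p hp => ?_, h3⟩
        rw [(h2 p hp).1 (h p hp)]
        exact Finset.mem_pi.1 hc p hp
    rw [hEq]
    exact abs_card_filter_modEq_sub_le hpos M N z
  have hcard : ((S.pi R).card : ℝ) = ∏ p ∈ S, ((R p).card : ℝ) := by
    rw [Finset.card_pi]; push_cast; rfl
  rw [Finset.card_eq_sum_card_fiberwise hmaps, Finset.prod_div_distrib, ← hcard]
  push_cast
  have e : (N : ℝ) * (((S.pi R).card : ℝ) / ∏ p ∈ S, (p : ℝ)) =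
      ∑ _c ∈ S.pi R, (N : ℝ) / ((∏ p ∈ S, p : ℕ) : ℝ) := by
    rw [Finset.sum_const, nsmul_eq_mul]
    push_cast
    ring
  rw [e, ← Finset.sum_sub_distrib]
  refine (Finset.abs_sum_le_sum_abs _ _).trans ((Finset.sum_le_sum hone).trans ?_)
  simp

theorem one_add_sum_le_prod_one_add {ι : Type*} (s : Finset ι) (f : ι → ℝ)
    (hf : ∀ i ∈ s, 0 ≤ f i) : 1 + ∑ i ∈ s, f i ≤ ∏ i ∈ s, (1 + f i) := by
  induction s using Finset.induction_on with
  | empty => simp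
  | insert j s hj ih =>
    have h1 := ih fun i hi => hf i (Finset.mem_insert_of_mem hi)
    have h2 := hf j (Finset.mem_insert_self j s)
    have h3 : 0 ≤ ∑ i ∈ s, f i :=
      Finset.sum_nonneg fun i hi => hf i (Finset.mem_insert_of_mem hi)
    rw [Finset.sum_insert hj, Finset.prod_insert hj]
    nlinarith [mul_nonneg h2 h3]

theorem prod_mul_one_add_sum_le (Z : ℕ) (hZ : 2 ≤ Z) (Q : Finset ℕ)
    (hQ3 : ∀ q ∈ Q, 3 ≤ q) (hlog : 4 * ∑ q ∈ Q, Real.log q / q ≤ Real.log Z) :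
    (∏ q ∈ Q, (1 + (1 : ℝ) / q)) * (1 + ∑ q ∈ Q, (1 : ℝ) / q) ≤
      2 * ∑ S ∈ Q.powerset with ∏ p ∈ S, p ≤ Z, ∏ q ∈ S, (2 : ℝ) / (q - 2) := by
  have hppos : ∀ p ∈ Q, (0 : ℝ) < p := fun p hp => by
    exact_mod_cast (by norm_num : 0 < 3).trans_le (hQ3 p hp)
  have hZ0 : (1 : ℝ) ≤ Z := by exact_mod_cast (by omega : 1 ≤ Z)
  have hlogZ : 0 < Real.log Z := Real.log_pos (by exact_mod_cast (by omega : 1 < Z))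
  set g : ℕ → ℝ := fun q => 2 / ((q : ℝ) - 2) with hg
  have hg0 : ∀ q ∈ Q, 0 ≤ g q := fun q hq => by
    have h3 : (3 : ℝ) ≤ q := by exact_mod_cast hQ3 q hq
    exact div_nonneg (by norm_num) (by linarith)
  set ρ := ∏ q ∈ Q, (1 + (1 : ℝ) / q) with hρ
  set σ := ∑ q ∈ Q, (1 : ℝ) / q with hσ
  have hρσ : 1 + σ ≤ ρ := one_add_sum_le_prod_one_add Q _ fun q _ => by positivity
  set A := ∑ S ∈ Q.powerset with ∏ p ∈ S, p ≤ Z, ∏ q ∈ S, g q with hA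
  have h1 : ρ * ρ ≤ ∏ q ∈ Q, (1 + g q) := by
    rw [hρ, ← Finset.prod_mul_distrib]
    refine Finset.prod_le_prod (fun q _ => by positivity) fun q hq => ?_
    simp only [hg]
    have h3 : (3 : ℝ) ≤ q := by exact_mod_cast hQ3 q hq
    have h4 : (0 : ℝ) < (q : ℝ) - 2 := by linarith
    have h5 : (0 : ℝ) < q := by linarith
    rw [← sub_nonneg]
    have : 1 + 2 / ((q : ℝ) - 2) - (1 + 1 / (q : ℝ)) * (1 + 1 / (q : ℝ)) =
        (3 * q + 2) / (q ^ 2 * (q - 2)) := by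
      field_simp
      ring
    rw [this]
    positivity
  have h2 := mul_sum_filter_powerset_le Q g (fun q => Real.log q) (Real.log Z)
    hg0 (fun q hq => Real.log_natCast_nonneg q)
  have h3 : ∑ q ∈ Q, Real.log q * (g q / (1 + g q)) = 2 * ∑ q ∈ Q, Real.log q / q := by
    rw [Finset.mul_sum]
    refine Finset.sum_congr rfl fun q hq => ?_
    simp only [hg]
    have h3 : (3 : ℝ) ≤ q := by exact_mod_cast hQ3 q hq
    have h4 : (q : ℝ) - 2 ≠ 0 := by linarith
    have h5 : (q : ℝ) ≠ 0 := by linarith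
    have h6 : 1 + 2 / ((q : ℝ) - 2) = q / (q - 2) := by field_simp; ring
    rw [h6]
    field_simp
  have h4 : Q.powerset.filter (fun S : Finset ℕ => Real.log Z < ∑ q ∈ S, Real.log (q : ℝ)) =
      Q.powerset.filter fun S => ¬ ∏ p ∈ S, p ≤ Z := by
    refine Finset.filter_congr fun S hS => ?_
    have hne : ∀ q ∈ S, (q : ℝ) ≠ 0 := fun q hq =>
      (hppos q (Finset.mem_powerset.1 hS hq)).ne'
    rw [← Real.log_prod hne, not_le, Real.log_lt_log_iff (by linarith)
      (Finset.prod_pos fun q hq => hppos q (Finset.mem_powerset.1 hS hq))]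
    rw [← Nat.cast_prod, Nat.cast_lt]
  rw [h4, h3] at h2
  have h5 : ∏ q ∈ Q, (1 + g q) = A + ∑ S ∈ Q.powerset with ¬ ∏ p ∈ S, p ≤ Z, ∏ q ∈ S, g q := by
    rw [Finset.prod_one_add, hA, Finset.sum_filter_add_sum_filter_not]
  set tail := ∑ S ∈ Q.powerset with ¬ ∏ p ∈ S, p ≤ Z, ∏ q ∈ S, g q with htail
  set F := ∏ q ∈ Q, (1 + g q) with hF
  have hF0 : 0 ≤ F := le_trans (mul_self_nonneg _) h1
  have h6 : Real.log Z * tail ≤ Real.log Z * (F / 2) := by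
    refine h2.trans ?_
    nlinarith
  have h7 := le_of_mul_le_mul_left h6 hlogZ
  have hρ0 : 0 ≤ ρ := Finset.prod_nonneg fun q _ => by positivity
  have h8 := mul_le_mul_of_nonneg_left hρσ hρ0
  linarith

theorem sum_prod_eq_mul_of_subset {P Q : Finset ℕ} (hQP : Q ⊆ P) (Z : ℕ) (g : ℕ → ℝ) :
    ∑ L ∈ P.powerset with ∏ p ∈ L ∩ Q, p ≤ Z ∧ ∏ p ∈ L \ Q, p ≤ Z, ∏ p ∈ L, g p =
      (∑ S ∈ Q.powerset with ∏ p ∈ S, p ≤ Z, ∏ p ∈ S, g p) *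
        ∑ S ∈ (P \ Q).powerset with ∏ p ∈ S, p ≤ Z, ∏ p ∈ S, g p := by
  have hmem : ∀ L, L ∈ P.powerset.filter (fun S => ∏ p ∈ S ∩ Q, p ≤ Z ∧ ∏ p ∈ S \ Q, p ≤ Z) ↔
      L ⊆ P ∧ ∏ p ∈ L ∩ Q, p ≤ Z ∧ ∏ p ∈ L \ Q, p ≤ Z := fun L => by
    rw [Finset.mem_filter, Finset.mem_powerset]
  rw [Finset.sum_mul_sum, ← Finset.sum_product']
  refine Finset.sum_nbij' (fun L => (L ∩ Q, L \ Q)) (fun x => x.1 ∪ x.2) ?_ ?_ ?_ ?_ ?_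
  · intro L hL
    obtain ⟨h0, h1, h2⟩ := (hmem L).1 hL
    simp only [Finset.mem_product, Finset.mem_filter, Finset.mem_powerset]
    exact ⟨⟨Finset.inter_subset_right, h1⟩, Finset.sdiff_subset_sdiff h0 subset_rfl, h2⟩
  · rintro ⟨S, T⟩ h
    simp only [Finset.mem_product, Finset.mem_filter, Finset.mem_powerset] at h
    obtain ⟨⟨h1, h2⟩, h3, h4⟩ := h
    have hTQ : Disjoint T Q := Finset.sdiff_disjoint.mono_left h3
    refine (hmem _).2 ⟨Finset.union_subset (h1.trans hQP) (h3.trans Finset.sdiff_subset), ?_, ?_⟩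
    · rw [Finset.union_inter_distrib_right, Finset.inter_eq_left.2 h1,
        Finset.disjoint_iff_inter_eq_empty.1 hTQ, Finset.union_empty]
      exact h2
    · rw [Finset.union_sdiff_distrib, Finset.sdiff_eq_empty_iff_subset.2 h1,
        Finset.empty_union, Finset.sdiff_eq_self_of_disjoint hTQ]
      exact h4
  · intro L _
    simp only
    rw [Finset.union_comm, Finset.sdiff_union_inter]
  · rintro ⟨S, T⟩ h
    simp only [Finset.mem_product, Finset.mem_filter, Finset.mem_powerset] at h
    obtain ⟨⟨h1, h2⟩, h3, h4⟩ := h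
    have hTQ : Disjoint T Q := Finset.sdiff_disjoint.mono_left h3
    simp only
    rw [Finset.union_inter_distrib_right, Finset.inter_eq_left.2 h1,
        Finset.disjoint_iff_inter_eq_empty.1 hTQ, Finset.union_empty,
        Finset.union_sdiff_distrib, Finset.sdiff_eq_empty_iff_subset.2 h1,
        Finset.empty_union, Finset.sdiff_eq_self_of_disjoint hTQ]
  · intro L _
    simp only
    rw [Finset.prod_inter_mul_prod_sdiff]

/-- The sieve with two residue classes removed modulo the primes of `Q` and one otherwise. -/
theorem card_sifted_primes_le (Z : ℕ) (hZ : 2 ≤ Z) (Q : Finset ℕ) (hQZ : Q ⊆ Nat.primesLE Z)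
    (hQ3 : ∀ q ∈ Q, 3 ≤ q) (hlog : 4 * ∑ q ∈ Q, Real.log q / q ≤ Real.log Z) (M N : ℕ) :
    (((Finset.Ioc M (M + N)).filter fun a =>
      ∀ p ∈ Nat.primesLE Z, ¬ a % p ∈ (if p ∈ Q then {0, 1} else {0} : Finset ℕ)).card : ℝ) ≤
      4 * N / (Real.log Z * (1 + ∑ q ∈ Q, (1 : ℝ) / q)) + (Z : ℝ) ^ 12 := by
  set P := Nat.primesLE Z with hP
  set R : ℕ → Finset ℕ := fun p => if p ∈ Q then {0, 1} else {0} with hR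
  have hPprime : ∀ p ∈ P, p.Prime := fun p hp => (Nat.mem_primesLE.1 hp).2
  have hRcard : ∀ p, ((R p).card : ℝ) = if p ∈ Q then 2 else 1 := by
    intro p
    simp only [hR]
    split_ifs <;> simp
  have hR1 : ∀ p, (1 : ℝ) ≤ (R p).card := fun p => by rw [hRcard]; split_ifs <;> norm_num
  have hRp : ∀ p ∈ P, ((R p).card : ℝ) < p := by
    intro p hp
    rw [hRcard]
    split_ifs with h
    · have : (3 : ℝ) ≤ p := by exact_mod_cast hQ3 p h
      linarith
    · exact_mod_cast (hPprime p hp).one_lt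
  have hppos : ∀ p ∈ P, (0 : ℝ) < p := fun p hp => by exact_mod_cast (hPprime p hp).pos
  set ν : ℕ → ℝ := fun p => ((R p).card : ℝ) / p with hν
  have hν01 : ∀ p ∈ P, 0 < ν p ∧ ν p < 1 := fun p hp =>
    ⟨div_pos (by linarith [hR1 p]) (hppos p hp), (div_lt_one (hppos p hp)).2 (hRp p hp)⟩
  set 𝓛 := P.powerset.filter fun S => ∏ p ∈ S ∩ Q, p ≤ Z ∧ ∏ p ∈ S \ Q, p ≤ Z with h𝓛
  have hmem : ∀ L, L ∈ 𝓛 ↔ L ⊆ P ∧ ∏ p ∈ L ∩ Q, p ≤ Z ∧ ∏ p ∈ L \ Q, p ≤ Z := fun L => by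
    rw [h𝓛, Finset.mem_filter, Finset.mem_powerset]
  have hprodle : ∀ L ∈ 𝓛, ∏ p ∈ L, p ≤ Z ^ 2 := by
    intro L hL
    obtain ⟨_, h1, h2⟩ := (hmem L).1 hL
    rw [← Finset.prod_inter_mul_prod_sdiff L Q, sq]
    exact Nat.mul_le_mul h1 h2
  have hmono : ∀ S ⊆ P, ∀ T ⊆ S, ∏ p ∈ T, p ≤ ∏ p ∈ S, p := fun S hS T hT =>
    Finset.prod_le_prod_of_subset_of_one_le' hT fun p hp _ => (hPprime p (hS hp)).one_le
  have hdown : ∀ L ∈ 𝓛, ∀ S ⊆ L, S ∈ 𝓛 := by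
    intro L hL S hSL
    obtain ⟨h0, h1, h2⟩ := (hmem L).1 hL
    refine (hmem S).2 ⟨hSL.trans h0, le_trans ?_ h1, le_trans ?_ h2⟩
    · exact hmono _ (Finset.inter_subset_left.trans h0) _ (Finset.inter_subset_inter_right hSL)
    · exact hmono _ (Finset.sdiff_subset.trans h0) _ (Finset.sdiff_subset_sdiff hSL subset_rfl)
  have h0 : ∅ ∈ 𝓛 := (hmem ∅).2 ⟨Finset.empty_subset _, by simp; omega, by simp; omega⟩
  have hr : ∀ S ⊆ P, |((((Finset.Ioc M (M + N)).filter fun a => ∀ p ∈ S, a % p ∈ R p).card : ℝ)) -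
      N * ∏ p ∈ S, ν p| ≤ ∏ p ∈ S, ((R p).card : ℝ) := fun S hS =>
    abs_card_filter_forall_mod_sub_le S (fun p hp => hPprime p (hS hp)) R (fun p hp v hv => by
      have h1 := (hPprime p (hS hp)).one_lt
      simp only [hR] at hv
      split_ifs at hv
      · rcases Finset.mem_insert.1 hv with rfl | hv
        · omega
        · rw [Finset.mem_singleton.1 hv]; exact h1
      · rw [Finset.mem_singleton.1 hv]; omega) M N
  have hmain := card_sifted_le P (Finset.Ioc M (M + N)) (fun p a => a % p ∈ R p) ν hν01 N
    (fun S => ∏ p ∈ S, ((R p).card : ℝ)) (fun S hS => by convert hr S hS) 𝓛 (fun L hL => ((hmem L).1 hL).1) hdown h0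
  have hZ0 : (1 : ℝ) ≤ Z := by exact_mod_cast (by omega : 1 ≤ Z)
  refine le_trans (le_of_eq (by congr!)) (hmain.trans (add_le_add ?_ ?_))
  · set g : ℕ → ℝ := fun p => ν p / (1 - ν p) with hg
    have hg0 : ∀ p ∈ P, 0 ≤ g p := fun p hp =>
      (div_pos (hν01 p hp).1 (by linarith [(hν01 p hp).2])).le
    have hgQ : ∀ q ∈ Q, g q = 2 / (q - 2) := by
      intro q hq
      have h3 : (3 : ℝ) ≤ q := by exact_mod_cast hQ3 q hq
      have h4 : (q : ℝ) - 2 ≠ 0 := by linarith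
      have h5 : (q : ℝ) ≠ 0 := by linarith
      simp only [hg, hν]
      rw [hRcard, if_pos hq]
      field_simp
    have hgn : ∀ p ∈ P \ Q, (1 : ℝ) / p ≤ g p := by
      intro p hp
      obtain ⟨hp, hq⟩ := Finset.mem_sdiff.1 hp
      obtain ⟨h1, h2⟩ := hν01 p hp
      simp only [hg]
      have h3 : ν p = 1 / p := by simp only [hν]; rw [hRcard, if_neg hq]
      rw [← h3, le_div_iff₀ (by linarith)]
      nlinarith
    set A := ∑ S ∈ Q.powerset with ∏ p ∈ S, p ≤ Z, ∏ p ∈ S, g p with hA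
    set B := ∑ S ∈ (P \ Q).powerset with ∏ p ∈ S, p ≤ Z, ∏ p ∈ S, g p with hB
    have hG : ∑ L ∈ 𝓛, ∏ p ∈ L, g p = A * B := sum_prod_eq_mul_of_subset hQZ Z g
    have hlogZ : 0 < Real.log Z := Real.log_pos (by exact_mod_cast (by omega : 1 < Z))
    set ρ := ∏ q ∈ Q, (1 + (1 : ℝ) / q) with hρ
    set σ := ∑ q ∈ Q, (1 : ℝ) / q with hσ
    have hσ0 : 0 ≤ σ := Finset.sum_nonneg fun q _ => by positivity
    have hρσ : 1 + σ ≤ ρ := one_add_sum_le_prod_one_add Q _ fun q _ => by positivity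
    have hBge : Real.log Z ≤ 2 * ρ * B := by
      refine (log_le_two_mul_prod_mul_sum Z Q).trans ?_
      refine mul_le_mul_of_nonneg_left ?_ (by linarith)
      refine Finset.sum_le_sum fun S hS => Finset.prod_le_prod (fun p _ => by positivity) ?_
      intro p hp
      exact hgn p (Finset.mem_powerset.1 (Finset.mem_filter.1 hS).1 hp)
    have hAge : ρ * (1 + σ) ≤ 2 * A := by
      refine (prod_mul_one_add_sum_le Z hZ Q hQ3 hlog).trans (le_of_eq ?_)
      congr 1
      refine Finset.sum_congr rfl fun S hS => Finset.prod_congr rfl fun q hq => ?_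
      rw [hgQ q (Finset.mem_powerset.1 (Finset.mem_filter.1 hS).1 hq)]
    have hρ0 : 0 < ρ := by linarith
    clear_value A B ρ σ
    have hGge : Real.log Z * (1 + σ) ≤ 4 * (A * B) := by
      have hB0 : 0 < B := by
        by_contra h
        have : 2 * ρ * B ≤ 0 := mul_nonpos_of_nonneg_of_nonpos (by linarith) (not_lt.1 h)
        linarith
      calc Real.log Z * (1 + σ) ≤ 2 * ρ * B * (1 + σ) := by gcongr
        _ = 2 * B * (ρ * (1 + σ)) := by ring
        _ ≤ 2 * B * (2 * A) := by gcongr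
        _ = 4 * (A * B) := by ring
    have hpos : 0 < Real.log Z * (1 + σ) := by positivity
    rw [hG, div_le_div_iff₀ (by linarith) hpos]
    nlinarith [(Nat.cast_nonneg N : (0 : ℝ) ≤ N)]
  · have hcard : (𝓛.card : ℝ) ≤ (Z : ℝ) ^ 2 := by
      have : 𝓛.card ≤ (Finset.Icc 1 (Z ^ 2)).card := by
        refine Finset.card_le_card_of_injOn (fun L => ∏ p ∈ L, p) ?_ ?_
        · intro L hL
          refine Finset.mem_coe.2 (Finset.mem_Icc.2 ⟨?_, hprodle L hL⟩)
          exact Finset.prod_pos fun p hp => (hPprime p (((hmem L).1 hL).1 hp)).pos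
        · intro S hS T hT h
          simp only at h
          rw [← Nat.primeFactors_prod fun p hp => hPprime p (((hmem S).1 hS).1 hp), h,
            Nat.primeFactors_prod fun p hp => hPprime p (((hmem T).1 hT).1 hp)]
      rw [Nat.card_Icc, Nat.add_sub_cancel] at this
      exact_mod_cast this
    have hprodleR : ∀ L ∈ 𝓛, ∏ p ∈ L, (p : ℝ) ≤ (Z : ℝ) ^ 2 := fun L hL => by
      rw [← Nat.cast_prod, ← Nat.cast_pow, Nat.cast_le]
      exact hprodle L hL
    have hinv : ∀ L ∈ 𝓛, (∏ p ∈ L, ν p)⁻¹ ≤ (Z : ℝ) ^ 2 := by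
      intro L hL
      refine le_trans ?_ (hprodleR L hL)
      rw [← Finset.prod_inv_distrib]
      refine Finset.prod_le_prod (fun p hp => ?_) fun p hp => ?_
      · exact inv_nonneg.2 (hν01 p (((hmem L).1 hL).1 hp)).1.le
      · have := hppos p (((hmem L).1 hL).1 hp)
        simp only [hν]
        rw [inv_div]
        exact div_le_self this.le (hR1 p)
    have hone : ∀ S ∈ 𝓛, ∀ T ∈ 𝓛, (∏ p ∈ S, ν p)⁻¹ * (∏ p ∈ T, ν p)⁻¹ *
        ∏ p ∈ S ∪ T, ((R p).card : ℝ) ≤ (Z : ℝ) ^ 8 := by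
      intro S hS T hT
      have hSP := ((hmem S).1 hS).1
      have hTP := ((hmem T).1 hT).1
      have h1 : ∏ p ∈ S ∪ T, ((R p).card : ℝ) ≤ (Z : ℝ) ^ 2 * (Z : ℝ) ^ 2 := by
        calc ∏ p ∈ S ∪ T, ((R p).card : ℝ) ≤ ∏ p ∈ S ∪ T, (p : ℝ) :=
              Finset.prod_le_prod (fun p _ => by positivity) fun p hp =>
                (hRp p (Finset.union_subset hSP hTP hp)).le
          _ ≤ (∏ p ∈ S ∪ T, (p : ℝ)) * ∏ p ∈ S ∩ T, (p : ℝ) := by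
              refine le_mul_of_one_le_right (Finset.prod_nonneg fun p _ => by positivity) ?_
              rw [← Nat.cast_prod, Nat.one_le_cast]
              exact Finset.one_le_prod' fun p hp =>
                (hPprime p (hSP (Finset.mem_inter.1 hp).1)).one_le
          _ = (∏ p ∈ S, (p : ℝ)) * ∏ p ∈ T, (p : ℝ) := Finset.prod_union_inter
          _ ≤ _ := by
              gcongr
              · exact hprodleR S hS
              · exact hprodleR T hT
      have h2 : 0 ≤ (∏ p ∈ T, ν p)⁻¹ :=
        inv_nonneg.2 (Finset.prod_nonneg fun p hp => (hν01 p (hTP hp)).1.le)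
      have h3 := mul_le_mul (mul_le_mul (hinv S hS) (hinv T hT) h2 (by positivity)) h1
        (Finset.prod_nonneg fun p _ => Nat.cast_nonneg _) (by positivity)
      refine h3.trans (le_of_eq ?_)
      ring
    refine (Finset.sum_le_sum fun S hS => Finset.sum_le_sum fun T hT =>
      (le_of_eq (by congr!)).trans (hone S hS T hT)).trans ?_
    rw [Finset.sum_const, Finset.sum_const, nsmul_eq_mul, nsmul_eq_mul]
    calc (𝓛.card : ℝ) * (𝓛.card * (Z : ℝ) ^ 8) ≤ (Z : ℝ) ^ 2 * ((Z : ℝ) ^ 2 * (Z : ℝ) ^ 8) :=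
          mul_le_mul hcard (mul_le_mul_of_nonneg_right hcard (by positivity)) (by positivity)
            (by positivity)
      _ = (Z : ℝ) ^ 12 := by ring

theorem sum_dyadicPrimes_add {a b d : ℕ} (hab : a ≤ b) (hbd : b ≤ d) (f : ℕ → ℝ) :
    ∑ p ∈ dyadicPrimes a b, f p + ∑ p ∈ dyadicPrimes b d, f p = ∑ p ∈ dyadicPrimes a d, f p := by
  have h1 : (2 : ℕ) ^ a ≤ 2 ^ b := Nat.pow_le_pow_right (by norm_num) hab
  have h2 : (2 : ℕ) ^ b ≤ 2 ^ d := Nat.pow_le_pow_right (by norm_num) hbd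
  rw [← Finset.sum_union]
  · refine Finset.sum_congr ?_ fun _ _ => rfl
    ext p
    simp only [Finset.mem_union, mem_dyadicPrimes]
    constructor
    · rintro (⟨⟨h, h'⟩, hp⟩ | ⟨⟨h, h'⟩, hp⟩)
      · exact ⟨⟨h, h'.trans h2⟩, hp⟩
      · exact ⟨⟨h1.trans_lt h, h'⟩, hp⟩
    · rintro ⟨⟨h, h'⟩, hp⟩
      rcases le_or_gt p (2 ^ b) with h3 | h3
      · exact Or.inl ⟨⟨h, h3⟩, hp⟩
      · exact Or.inr ⟨⟨h3, h'⟩, hp⟩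
  · rw [Finset.disjoint_left]
    intro p hp hq
    exact absurd (mem_dyadicPrimes.1 hp).1.2 (not_le.2 (mem_dyadicPrimes.1 hq).1.1)

theorem sum_dyadicPrimes_eq_sum_Ico {a b : ℕ} (hab : a ≤ b) (f : ℕ → ℝ) :
    ∑ p ∈ dyadicPrimes a b, f p = ∑ i ∈ Finset.Ico a b, ∑ p ∈ dyadicPrimes i (i + 1), f p := by
  induction b, hab using Nat.le_induction with
  | base =>
    rw [Finset.Ico_self, Finset.sum_empty]
    refine Finset.sum_eq_zero fun p hp => ?_
    have := (mem_dyadicPrimes.1 hp).1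
    omega
  | succ b hab ih =>
    rw [Finset.sum_Ico_succ_top hab, ← ih, sum_dyadicPrimes_add hab (Nat.le_succ b)]

theorem exists_sum_inv_dyadicPrimes_two_pow_mul_ge :
    ∃ a₀ : ℕ, ∀ a, a₀ ≤ a → 1 ≤ a → ∀ k : ℕ,
      (k : ℝ) / 3 ≤ ∑ p ∈ dyadicPrimes a (2 ^ k * a), (1 : ℝ) / p := by
  obtain ⟨C, hC⟩ := exists_sum_inv_dyadicPrimes_ge
  refine ⟨3 * C, fun a ha ha1 k => ?_⟩
  induction k with
  | zero =>
    rw [Nat.cast_zero, zero_div]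
    exact Finset.sum_nonneg fun _ _ => by positivity
  | succ k ih =>
    have hk : 1 ≤ 2 ^ k := Nat.one_le_two_pow
    have h1 : a ≤ 2 ^ k * a := Nat.le_mul_of_pos_left _ hk
    have h2 : 2 ^ k * a ≤ 2 ^ (k + 1) * a :=
      Nat.mul_le_mul_right _ (Nat.pow_le_pow_right (by norm_num) (Nat.le_succ k))
    rw [← sum_dyadicPrimes_add h1 h2]
    have h3 := hC _ _ h2
    set σ := ∑ p ∈ dyadicPrimes (2 ^ k * a) (2 ^ (k + 1) * a), (1 : ℝ) / p
    have h4 : (3 * C : ℝ) ≤ (2 ^ k * a : ℕ) := by exact_mod_cast ha.trans h1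
    have h5 : (0 : ℝ) < (2 ^ k * a : ℕ) := by exact_mod_cast (by omega : 0 < 2 ^ k * a)
    have h6 : ((2 ^ (k + 1) * a : ℕ) : ℝ) = 2 * (2 ^ k * a : ℕ) := by push_cast; ring
    rw [h6] at h3
    set y := ((2 ^ k * a : ℕ) : ℝ)
    have h7 : 1 / 3 ≤ σ := by
      by_contra h
      have : 2 * y * σ < 2 * y * (1 / 3) := mul_lt_mul_of_pos_left (not_le.1 h) (by linarith)
      linarith
    push_cast
    linarith

theorem Nat.sq_le_four_mul_two_pow (n : ℕ) : n ^ 2 ≤ 4 * 2 ^ n := by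
  induction n with
  | zero => simp
  | succ n ih =>
    have h : n < 2 ^ n := Nat.lt_two_pow_self
    rw [pow_succ 2 n]
    nlinarith

/-- `p - 1` has a prime factor in `(2 ^ a, 2 ^ b]`. -/
def PredHasPrime (a b p : ℕ) : Prop :=
  ∃ q ∈ dyadicPrimes a b, q ∣ p - 1

/-- Few primes `p ≤ 2 ^ (b + 1)` are such that `p - 1` avoids all primes of a long dyadic range. -/
theorem exists_card_dyadicPrimes_not_dvd_le (ε : ℝ) (hε : 0 < ε) :
    ∃ c E a₀ : ℕ, 2 ≤ c ∧ 1 ≤ E ∧ 1 ≤ a₀ ∧ ∀ a b, a₀ ≤ a → E * a ≤ b →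
      (((dyadicPrimes b (b + 1)).filter fun p =>
        ¬ PredHasPrime a (c * a) p).card : ℝ) ≤ ε * 2 ^ b / b := by
  obtain ⟨a₁, ha₁⟩ := exists_sum_inv_dyadicPrimes_two_pow_mul_ge
  obtain ⟨C, hC⟩ := exists_sum_log_div_dyadicPrimes
  obtain ⟨k, hk⟩ := exists_nat_ge (1248 / ε + 1)
  obtain ⟨b₀, hb₀⟩ := exists_nat_ge (5408 / ε)
  have hk1 : 1 ≤ k := by
    have : (0 : ℝ) < 1248 / ε := by positivity
    exact_mod_cast (by linarith : (1 : ℝ) ≤ k)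
  refine ⟨2 ^ k, 13 * (4 * 2 ^ k + 4 * C + 1), a₁ + b₀ + 1, ?_, by omega, by omega, ?_⟩
  · calc 2 = 2 ^ 1 := by norm_num
      _ ≤ 2 ^ k := Nat.pow_le_pow_right (by norm_num) hk1
  intro a b ha hb
  set c := 2 ^ k with hc
  have hc1 : 1 ≤ c := Nat.one_le_two_pow
  set ζ := b / 13 with hζ
  have hζa : (4 * c + 4 * C + 1) * a ≤ ζ := by
    rw [hζ, Nat.le_div_iff_mul_le (by norm_num)]
    linarith
  have hζ1 : 4 * (c * a) + 4 * C ≤ ζ := by nlinarith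
  have hζ2 : a ≤ ζ := by nlinarith
  have hζb : b ≤ 26 * ζ := by omega
  have hζb' : 13 * ζ ≤ b := by omega
  have hσ := ha₁ a (by omega) (by omega) k
  rw [← hc] at hσ
  set Q := dyadicPrimes a (c * a) with hQ
  have hZ : 2 ≤ 2 ^ ζ := Nat.le_self_pow (by omega) 2
  have hQZ : Q ⊆ Nat.primesLE (2 ^ ζ) := by
    intro q hq
    obtain ⟨⟨_, h2⟩, h3⟩ := mem_dyadicPrimes.1 hq
    exact Nat.mem_primesLE.2 ⟨h2.trans (Nat.pow_le_pow_right (by norm_num) (by omega)), h3⟩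
  have hQ3 : ∀ q ∈ Q, 3 ≤ q := by
    intro q hq
    have h1 := (mem_dyadicPrimes.1 hq).1.1
    have h2 : 2 ≤ 2 ^ a := Nat.le_self_pow (by omega) 2
    omega
  have hlog2 : 1 / 2 < Real.log 2 := by linarith [Real.log_two_gt_d9]
  have hlogZ : Real.log ((2 ^ ζ : ℕ) : ℝ) = ζ * Real.log 2 := by
    push_cast
    rw [Real.log_pow]
  have hlog : 4 * ∑ q ∈ Q, Real.log q / q ≤ Real.log ((2 ^ ζ : ℕ) : ℝ) := by
    have h1 := (hC a (c * a) (Nat.le_mul_of_pos_left _ hc1)).2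
    have h2 : (4 * (c * a : ℕ) + 4 * C : ℝ) ≤ ζ := by exact_mod_cast hζ1
    rw [hlogZ]
    calc 4 * ∑ q ∈ Q, Real.log q / q ≤ 4 * ((((c * a : ℕ) : ℝ) - a + C) * Real.log 2) := by linarith
      _ = (4 * ((c * a : ℕ) : ℝ) + 4 * C - 4 * a) * Real.log 2 := by ring
      _ ≤ ζ * Real.log 2 := by
          have : (0 : ℝ) ≤ a := Nat.cast_nonneg a
          gcongr
          linarith
  have hsieve := card_sifted_primes_le (2 ^ ζ) hZ Q hQZ hQ3 hlog (2 ^ b) (2 ^ b)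
  have hsub : (dyadicPrimes b (b + 1)).filter (fun p => ¬ PredHasPrime a (c * a) p) ⊆
      (Finset.Ioc (2 ^ b) (2 ^ b + 2 ^ b)).filter fun x => ∀ p ∈ Nat.primesLE (2 ^ ζ),
        ¬ x % p ∈ (if p ∈ Q then {0, 1} else {0} : Finset ℕ) := by
    intro p hp
    obtain ⟨hp, hpQ⟩ := Finset.mem_filter.1 hp
    obtain ⟨⟨h1, h2⟩, hpp⟩ := mem_dyadicPrimes.1 hp
    refine Finset.mem_filter.2 ⟨Finset.mem_Ioc.2 ⟨h1, by rw [pow_succ] at h2; omega⟩, ?_⟩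
    intro l hl hmem
    obtain ⟨hlZ, hlp⟩ := Nat.mem_primesLE.1 hl
    have h0 : p % l ≠ 0 := by
      intro h
      rcases (Nat.dvd_prime hpp).1 (Nat.dvd_of_mod_eq_zero h) with h3 | h3
      · exact hlp.one_lt.ne' h3
      · have : 2 ^ ζ ≤ 2 ^ b := Nat.pow_le_pow_right (by norm_num) (by omega)
        omega
    split_ifs at hmem with hlQ
    · rcases Finset.mem_insert.1 hmem with h | h
      · exact h0 h
      · refine hpQ ⟨l, hlQ, (Nat.modEq_iff_dvd' hpp.one_le).1 ?_⟩
        rw [Nat.ModEq, Finset.mem_singleton.1 h, Nat.mod_eq_of_lt hlp.one_lt]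
    · exact h0 (Finset.mem_singleton.1 hmem)
  have hcard : (((dyadicPrimes b (b + 1)).filter fun p => ¬ PredHasPrime a (c * a) p).card : ℝ) ≤ _ :=
    (Nat.cast_le.2 (Finset.card_le_card hsub)).trans hsieve
  refine hcard.trans ?_
  rw [hlogZ]
  push_cast
  set σ := ∑ q ∈ Q, (1 : ℝ) / q
  have hb0 : (0 : ℝ) < b := by exact_mod_cast (by omega : 0 < b)
  have hζ0 : (0 : ℝ) < ζ := by exact_mod_cast (by omega : 0 < ζ)
  have hbζ : (b : ℝ) ≤ 26 * ζ := by exact_mod_cast hζb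
  have hX : (0 : ℝ) < 2 ^ b := by positivity
  have hk' : 1248 ≤ ε * k := by
    have : 1248 / ε ≤ k := by linarith
    rwa [div_le_iff₀ hε, mul_comm] at this
  have hbε : 5408 ≤ ε * b := by
    have h1 : (b₀ : ℝ) ≤ b := by exact_mod_cast (by nlinarith : b₀ ≤ b)
    have : 5408 / ε ≤ b := hb₀.trans h1
    rwa [div_le_iff₀ hε, mul_comm] at this
  have hfirst : 4 * (2 : ℝ) ^ b / (ζ * Real.log 2 * (1 + σ)) ≤ ε / 2 * 2 ^ b / b := by
    have hσ1 : (k : ℝ) / 3 ≤ 1 + σ := by linarith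
    have hk0 : (0 : ℝ) < k := by exact_mod_cast hk1
    have h1 : (b : ℝ) / 26 * (1 / 2) * (k / 3) ≤ ζ * Real.log 2 * (1 + σ) := by
      gcongr
      linarith
    have h2 : (0 : ℝ) < (b : ℝ) / 26 * (1 / 2) * (k / 3) := by positivity
    calc 4 * (2 : ℝ) ^ b / (ζ * Real.log 2 * (1 + σ))
        ≤ 4 * (2 : ℝ) ^ b / ((b : ℝ) / 26 * (1 / 2) * (k / 3)) := by gcongr
      _ = 624 / k * 2 ^ b / b := by field_simp; ring
      _ ≤ ε / 2 * 2 ^ b / b := by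
          have h3 : 624 / (k : ℝ) ≤ ε / 2 := by
            rw [div_le_iff₀ hk0]
            linarith
          exact div_le_div_of_nonneg_right (mul_le_mul_of_nonneg_right h3 hX.le) hb0.le
  have hsecond : ((2 : ℝ) ^ ζ) ^ 12 ≤ ε / 2 * 2 ^ b / b := by
    have h1 : ((2 : ℝ) ^ ζ) ^ 12 * 2 ^ ζ ≤ 2 ^ b := by
      rw [← pow_mul, ← pow_add]
      exact pow_le_pow_right₀ (by norm_num) (by omega)
    have h2 : (ζ : ℝ) ^ 2 ≤ 4 * 2 ^ ζ := by exact_mod_cast Nat.sq_le_four_mul_two_pow ζ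
    have h3 : (b : ℝ) * 2 ≤ ε * 2 ^ ζ := by
      have h4 : (b : ℝ) ^ 2 ≤ 676 * (4 * 2 ^ ζ) := by nlinarith
      have h5 : 5408 * b ≤ ε * b * b := mul_le_mul_of_nonneg_right hbε hb0.le
      nlinarith
    rw [le_div_iff₀ hb0]
    have h6 : (0 : ℝ) < ((2 : ℝ) ^ ζ) ^ 12 := by positivity
    have h7 : ((2 : ℝ) ^ ζ) ^ 12 * (b * 2) ≤ ((2 : ℝ) ^ ζ) ^ 12 * (ε * 2 ^ ζ) :=
      mul_le_mul_of_nonneg_left h3 h6.le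
    have h8 := mul_le_mul_of_nonneg_left h1 hε.le
    nlinarith
  have : ε * 2 ^ b / b = ε / 2 * 2 ^ b / b + ε / 2 * 2 ^ b / b := by ring
  rw [this]
  exact add_le_add hfirst hsecond

/-- A positive proportion of the primes `p`, weighted by `1 / p`, is such that `p - 1` has a prime
factor in a long dyadic range. -/
theorem exists_sum_inv_dyadicPrimes_dvd_ge :
    ∃ c E a₀ : ℕ, 2 ≤ c ∧ 1 ≤ E ∧ 1 ≤ a₀ ∧ ∀ a b, a₀ ≤ a → E * a ≤ b →
      (1 : ℝ) / 6 ≤ ∑ p ∈ dyadicPrimes b (2 * b) with PredHasPrime a (c * a) p,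
        (1 : ℝ) / p := by
  obtain ⟨c, E, a₁, hc, hE, ha₁, H⟩ := exists_card_dyadicPrimes_not_dvd_le (1 / 6) (by norm_num)
  obtain ⟨a₂, ha₂⟩ := exists_sum_inv_dyadicPrimes_two_pow_mul_ge
  refine ⟨c, E, a₁ + a₂, hc, hE, by omega, fun a b ha hb => ?_⟩
  have hba : a ≤ b := le_trans (Nat.le_mul_of_pos_left _ hE) hb
  have hb1 : 1 ≤ b := by omega
  have h1 := ha₂ b (by omega) hb1 1
  rw [pow_one] at h1
  rw [← Finset.sum_filter_add_sum_filter_not _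
    (fun p => PredHasPrime a (c * a) p)] at h1
  have h2 : ∑ p ∈ dyadicPrimes b (2 * b) with ¬ PredHasPrime a (c * a) p,
      (1 : ℝ) / p ≤ 1 / 6 := by
    rw [Finset.sum_filter, sum_dyadicPrimes_eq_sum_Ico (by omega)]
    have hb0 : (0 : ℝ) < b := by exact_mod_cast hb1
    calc _ ≤ ∑ i ∈ Finset.Ico b (2 * b), 1 / 6 / (b : ℝ) := by
          refine Finset.sum_le_sum fun i hi => ?_
          obtain ⟨hi1, hi2⟩ := Finset.mem_Ico.1 hi
          rw [← Finset.sum_filter]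
          have h3 : (0 : ℝ) < 2 ^ i := by positivity
          have h4 : (b : ℝ) ≤ i := by exact_mod_cast hi1
          calc _ ≤ ∑ p ∈ dyadicPrimes i (i + 1) with
                  ¬ PredHasPrime a (c * a) p, (1 : ℝ) / 2 ^ i := by
                refine Finset.sum_le_sum fun p hp => ?_
                have h5 := (mem_dyadicPrimes.1 (Finset.mem_filter.1 hp).1).1.1
                have h6 : (2 : ℝ) ^ i ≤ p := by exact_mod_cast h5.le
                gcongr
            _ ≤ 1 / 6 * 2 ^ i / i * (1 / 2 ^ i) := by
                rw [Finset.sum_const, nsmul_eq_mul]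
                exact mul_le_mul_of_nonneg_right (H a i (by omega) (hb.trans hi1)) (by positivity)
            _ = 1 / 6 / i := by field_simp
            _ ≤ 1 / 6 / (b : ℝ) := by gcongr
      _ = 1 / 6 := by
          rw [Finset.sum_const, Nat.card_Ico, nsmul_eq_mul, show 2 * b - b = b by omega]
          field_simp
  norm_num at h1 ⊢
  norm_num at h2
  linarith

theorem sum_powerset_card_filter_lt_le (P : Finset ℕ) (hP : ∀ p ∈ P, 1 ≤ p) (R : ℕ → Prop)
    (K : ℕ) :
    ∑ S ∈ P.powerset with (S.filter R).card < K, ∏ p ∈ S, (1 : ℝ) / p ≤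
      (∏ p ∈ P, (1 + (1 : ℝ) / p)) * (2 ^ K * Real.exp (-(∑ p ∈ P with R p, (1 : ℝ) / p) / 4)) := by
  have h1 : ∀ S ∈ P.powerset.filter (fun S => (S.filter R).card < K),
      ∏ p ∈ S, (1 : ℝ) / p ≤ 2 ^ K * ∏ p ∈ S, (1 : ℝ) / p * (if R p then 1 / 2 else 1) := by
    intro S hS
    have h2 := (Finset.mem_filter.1 hS).2
    rw [Finset.prod_mul_distrib, ← Finset.prod_filter, Finset.prod_const]
    have h3 : (0 : ℝ) ≤ ∏ p ∈ S, (1 : ℝ) / p := Finset.prod_nonneg fun p _ => by positivity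
    have h4 : (1 : ℝ) ≤ 2 ^ K * (1 / 2) ^ (S.filter R).card := by
      rw [one_div, inv_pow, ← div_eq_mul_inv, one_le_div (by positivity)]
      exact pow_le_pow_right₀ (by norm_num) h2.le
    nlinarith
  have h2 : ∏ p ∈ P, (1 + (1 : ℝ) / p * (if R p then 1 / 2 else 1)) ≤
      (∏ p ∈ P, (1 + (1 : ℝ) / p)) * Real.exp (-(∑ p ∈ P with R p, (1 : ℝ) / p) / 4) := by
    have h3 : Real.exp (-(∑ p ∈ P with R p, (1 : ℝ) / p) / 4) =
        ∏ p ∈ P, if R p then Real.exp (-((1 : ℝ) / p) / 4) else 1 := by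
      rw [← Finset.prod_filter, ← Real.exp_sum, ← Finset.sum_div, Finset.sum_neg_distrib]
    rw [h3, ← Finset.prod_mul_distrib]
    refine Finset.prod_le_prod (fun p _ => ?_) fun p hp => ?_
    · split_ifs <;> positivity
    · split_ifs
      · have h4 : (1 : ℝ) ≤ p := by exact_mod_cast hP p hp
        have h5 : (1 : ℝ) / p ≤ 1 := by rw [div_le_one (by linarith)]; exact h4
        have h6 : (0 : ℝ) ≤ 1 / p := by positivity
        set x := (1 : ℝ) / p
        have h7 := Real.add_one_le_exp (-x / 4)
        calc 1 + x * (1 / 2) ≤ (1 + x) * (-x / 4 + 1) := by nlinarith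
          _ ≤ _ := by gcongr
      · rw [mul_one, mul_one]
  calc _ ≤ ∑ S ∈ P.powerset with (S.filter R).card < K,
        2 ^ K * ∏ p ∈ S, (1 : ℝ) / p * (if R p then 1 / 2 else 1) := Finset.sum_le_sum h1
    _ ≤ ∑ S ∈ P.powerset, 2 ^ K * ∏ p ∈ S, (1 : ℝ) / p * (if R p then 1 / 2 else 1) := by
        refine Finset.sum_le_sum_of_subset_of_nonneg (Finset.filter_subset _ _) fun S _ _ => ?_
        refine mul_nonneg (by positivity) (Finset.prod_nonneg fun p _ => ?_)
        split_ifs <;> positivity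
    _ = 2 ^ K * ∏ p ∈ P, (1 + (1 : ℝ) / p * (if R p then 1 / 2 else 1)) := by
        rw [← Finset.mul_sum, Finset.prod_one_add]
    _ ≤ 2 ^ K * ((∏ p ∈ P, (1 + (1 : ℝ) / p)) *
          Real.exp (-(∑ p ∈ P with R p, (1 : ℝ) / p) / 4)) := by gcongr
    _ = _ := by ring

theorem mul_log_two_le_prod_dyadicPrimes (w : ℕ) :
    w * Real.log 2 ≤ 3 * ∏ p ∈ dyadicPrimes 1 w, (1 + (1 : ℝ) / p) := by
  have h := log_le_two_mul_prod_mul_sum (2 ^ w) {2}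
  rw [Finset.prod_singleton] at h
  have h1 : Nat.primesLE (2 ^ w) \ {2} = dyadicPrimes 1 w := by
    ext p
    rw [Finset.mem_sdiff, Nat.mem_primesLE, Finset.mem_singleton, mem_dyadicPrimes, pow_one]
    constructor
    · rintro ⟨⟨h1, h2⟩, h3⟩
      exact ⟨⟨lt_of_le_of_ne h2.two_le (Ne.symm h3), h1⟩, h2⟩
    · rintro ⟨⟨h1, h2⟩, h3⟩
      exact ⟨⟨h2, h3⟩, h1.ne'⟩
  rw [h1] at h
  have h2 : ∑ S ∈ (dyadicPrimes 1 w).powerset with ∏ p ∈ S, p ≤ 2 ^ w, ∏ p ∈ S, (1 : ℝ) / p ≤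
      ∏ p ∈ dyadicPrimes 1 w, (1 + (1 : ℝ) / p) := by
    rw [Finset.prod_one_add]
    exact Finset.sum_le_sum_of_subset_of_nonneg (Finset.filter_subset _ _) fun S _ _ =>
      Finset.prod_nonneg fun p _ => by positivity
  push_cast at h
  rw [Real.log_pow] at h
  refine h.trans ?_
  norm_num at h2 ⊢
  exact h2

theorem sum_inv_filter_dyadicPrimes_ge {b : ℕ} (hb : 1 ≤ b) (R : ℕ → Prop)
    (H : ∀ d, b ≤ d → (1 : ℝ) / 6 ≤ ∑ p ∈ dyadicPrimes d (2 * d) with R p, (1 : ℝ) / p)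
    {k w : ℕ} (hkw : 2 ^ k * b ≤ w) :
    (k : ℝ) / 6 ≤ ∑ p ∈ dyadicPrimes 1 w with R p, (1 : ℝ) / p := by
  have key : ∀ k : ℕ, (k : ℝ) / 6 ≤
      ∑ p ∈ dyadicPrimes b (2 ^ k * b) with R p, (1 : ℝ) / p := by
    intro k
    induction k with
    | zero =>
      rw [Nat.cast_zero, zero_div]
      exact Finset.sum_nonneg fun _ _ => by positivity
    | succ k ih =>
      have h1 : b ≤ 2 ^ k * b := Nat.le_mul_of_pos_left _ (by positivity)
      have h2 : 2 ^ (k + 1) * b = 2 * (2 ^ k * b) := by ring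
      have h3 := H (2 ^ k * b) h1
      rw [Finset.sum_filter] at h3 ih ⊢
      rw [h2, ← sum_dyadicPrimes_add h1 (by omega)]
      push_cast
      linarith
  refine (key _).trans (Finset.sum_le_sum_of_subset_of_nonneg ?_ fun _ _ _ => by positivity)
  refine Finset.filter_subset_filter _ fun p hp => ?_
  obtain ⟨⟨h1, h2⟩, h3⟩ := mem_dyadicPrimes.1 hp
  refine mem_dyadicPrimes.2 ⟨⟨lt_of_le_of_lt ?_ h1, h2.trans ?_⟩, h3⟩
  · exact Nat.pow_le_pow_right (by norm_num) hb
  · exact Nat.pow_le_pow_right (by norm_num) hkw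

theorem sum_sum_powerset_card_filter_lt_le (P : Finset ℕ) (hP : ∀ p ∈ P, 1 ≤ p)
    (R : ℕ → ℕ → Prop) (K n J : ℕ) (hn : Real.exp (-(1 / 24)) ^ n <
      (1 - Real.exp (-(1 / 24))) / (4 * 2 ^ K))
    (hscale : ∀ j < J, ((J - j + n : ℕ) : ℝ) / 6 ≤ ∑ p ∈ P with R j p, (1 : ℝ) / p) :
    ∑ j ∈ Finset.range J, ∑ S ∈ P.powerset with (S.filter (R j)).card < K,
      ∏ p ∈ S, (1 : ℝ) / p ≤ (∏ p ∈ P, (1 + (1 : ℝ) / p)) / 4 := by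
  set θ := Real.exp (-(1 / 24)) with hθ
  have hθ0 : 0 < θ := Real.exp_pos _
  set F := ∏ p ∈ P, (1 + (1 : ℝ) / p) with hF
  have hF0 : 0 ≤ F := Finset.prod_nonneg fun p _ => by positivity
  calc _ ≤ ∑ j ∈ Finset.range J, F * (2 ^ K * (θ ^ n * θ ^ (J - 1 - j))) := by
        refine Finset.sum_le_sum fun j hj => ?_
        have hj' := Finset.mem_range.1 hj
        refine (sum_powerset_card_filter_lt_le P hP (R j) K).trans ?_
        have h1 := hscale j hj'
        rw [← pow_add, hθ, ← Real.exp_nat_mul]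
        gcongr
        have h2 : (J - j + n : ℕ) = (n + (J - 1 - j)) + 1 := by omega
        rw [h2] at h1
        push_cast at h1 ⊢
        linarith
    _ = F * 2 ^ K * θ ^ n * ∑ j ∈ Finset.range J, θ ^ j := by
        rw [← Finset.sum_range_reflect (fun j => θ ^ j) J, Finset.mul_sum]
        refine Finset.sum_congr rfl fun j _ => ?_
        ring
    _ ≤ F / 4 := by
        have h1 : (∑ j ∈ Finset.range J, θ ^ j) * (1 - θ) ≤ 1 := by
          rw [geom_sum_mul_neg]
          linarith [pow_pos hθ0 J]
        have h2 : θ ^ n * (4 * 2 ^ K) ≤ 1 - θ := by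
          rw [← le_div_iff₀ (by positivity)]
          exact hn.le
        have h3 : 0 ≤ ∑ j ∈ Finset.range J, θ ^ j :=
          Finset.sum_nonneg fun _ _ => by positivity
        have h4 := (mul_le_mul_of_nonneg_left h2 h3).trans h1
        calc _ = F / 4 * ((∑ j ∈ Finset.range J, θ ^ j) * (θ ^ n * (4 * 2 ^ K))) := by ring
          _ ≤ F / 4 * 1 := by gcongr
          _ = F / 4 := mul_one _

theorem exists_sum_powerset_prod_gt_le :
    ∃ C : ℕ, ∀ w : ℕ, C ≤ w → 1 ≤ w →
      ∑ S ∈ (dyadicPrimes 1 w).powerset with ¬ ∏ p ∈ S, p ≤ 2 ^ (8 * w), ∏ p ∈ S, (1 : ℝ) / p ≤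
        (∏ p ∈ dyadicPrimes 1 w, (1 + (1 : ℝ) / p)) / 4 := by
  obtain ⟨C, hC⟩ := exists_sum_log_div_dyadicPrimes
  refine ⟨C, fun w hCw hw1 => ?_⟩
  set P := dyadicPrimes 1 w with hP
  have hP1 : ∀ p ∈ P, 1 ≤ p := fun p hp => (mem_dyadicPrimes.1 hp).2.one_le
  set F := ∏ p ∈ P, (1 + (1 : ℝ) / p) with hF
  have hF0 : 0 ≤ F := Finset.prod_nonneg fun p _ => by positivity
  have h1 := mul_sum_filter_powerset_le P (fun p => (1 : ℝ) / p) (fun p => Real.log p)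
    (8 * w * Real.log 2) (fun p _ => by positivity) fun p _ => Real.log_natCast_nonneg p
  have h2 : P.powerset.filter (fun S : Finset ℕ =>
      8 * w * Real.log 2 < ∑ p ∈ S, Real.log (p : ℝ)) =
      P.powerset.filter fun S => ¬ ∏ p ∈ S, p ≤ 2 ^ (8 * w) := by
    refine Finset.filter_congr fun S hS => ?_
    have hpos : ∀ p ∈ S, (0 : ℝ) < p := fun p hp => by
      exact_mod_cast hP1 p (Finset.mem_powerset.1 hS hp)
    have h3 : 8 * w * Real.log 2 = Real.log ((2 ^ (8 * w) : ℕ) : ℝ) := by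
      push_cast
      rw [Real.log_pow]
      push_cast
      ring
    rw [h3, ← Real.log_prod fun p hp => (hpos p hp).ne', not_le, ← Nat.cast_prod,
      Real.log_lt_log_iff (by positivity) (by rw [Nat.cast_prod]; exact Finset.prod_pos hpos),
      Nat.cast_lt]
  rw [h2] at h1
  have h3 : ∑ p ∈ P, Real.log p * ((1 : ℝ) / p / (1 + 1 / p)) ≤ 2 * w * Real.log 2 := by
    have h4 := (hC 1 w hw1).2
    have h5 : (C : ℝ) ≤ w := by exact_mod_cast hCw
    have h6 : 0 < Real.log 2 := Real.log_pos (by norm_num)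
    calc _ ≤ ∑ p ∈ P, Real.log p / p := by
          refine Finset.sum_le_sum fun p _ => ?_
          rw [div_eq_mul_one_div (Real.log p)]
          refine mul_le_mul_of_nonneg_left ?_ (Real.log_natCast_nonneg p)
          refine div_le_self (by positivity) ?_
          have : (0 : ℝ) ≤ 1 / p := by positivity
          linarith
      _ ≤ (w - (1 : ℕ) + C) * Real.log 2 := h4
      _ ≤ 2 * w * Real.log 2 := by
          gcongr
          push_cast
          linarith
  have hw0 : (0 : ℝ) < w := by exact_mod_cast hw1
  have h6 : 0 < Real.log 2 := Real.log_pos (by norm_num)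
  have h7 : (0 : ℝ) < 8 * w * Real.log 2 := by positivity
  refine le_of_mul_le_mul_left (h1.trans ?_) h7
  calc _ ≤ F * (2 * w * Real.log 2) := by gcongr
    _ = _ := by ring

/-- Many integers, weighted by `1 / m`, have at every scale several prime factors `p` such that
`p - 1` has a prime factor of that scale. -/
theorem exists_sum_good_subsets_ge :
    ∃ c a₀ : ℕ, 2 ≤ c ∧ 1 ≤ a₀ ∧ ∀ K : ℕ, ∃ J₀ : ℕ, ∀ J w : ℕ, w = a₀ * c ^ (J + J₀) →
      w * Real.log 2 / 6 ≤ ∑ S ∈ (dyadicPrimes 1 w).powerset with ∏ p ∈ S, p ≤ 2 ^ (8 * w) ∧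
        ∀ j < J, K ≤ (S.filter fun p =>
          PredHasPrime (a₀ * c ^ j) (c * (a₀ * c ^ j)) p).card,
        ∏ p ∈ S, (1 : ℝ) / p := by
  obtain ⟨c, E, a₁, hc, hE, ha₁, H⟩ := exists_sum_inv_dyadicPrimes_dvd_ge
  obtain ⟨C, hC⟩ := exists_sum_powerset_prod_gt_le
  refine ⟨c, a₁ + C, hc, by omega, fun K => ?_⟩
  set a₀ := a₁ + C with ha₀
  set θ := Real.exp (-(1 / 24)) with hθ
  have hθ0 : 0 < θ := Real.exp_pos _
  have hθ1 : θ < 1 := Real.exp_lt_one_iff.2 (by norm_num)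
  obtain ⟨n, hn⟩ := exists_pow_lt_of_lt_one (show 0 < (1 - θ) / (4 * 2 ^ K) by
    have : 0 < 1 - θ := by linarith
    positivity) hθ1
  refine ⟨E + n, fun J w hw => ?_⟩
  set R : ℕ → ℕ → Prop := fun j =>
    PredHasPrime (a₀ * c ^ j) (c * (a₀ * c ^ j)) with hR
  set P := dyadicPrimes 1 w with hP
  have hP1 : ∀ p ∈ P, 1 ≤ p := fun p hp => (mem_dyadicPrimes.1 hp).2.one_le
  set F := ∏ p ∈ P, (1 + (1 : ℝ) / p) with hF
  have hF0 : 0 ≤ F := Finset.prod_nonneg fun p _ => by positivity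
  have hcpos : ∀ i, 1 ≤ c ^ i := fun i => Nat.one_le_pow _ _ (by omega)
  have hwa : a₀ ≤ w := hw ▸ Nat.le_mul_of_pos_right _ (hcpos _)
  have hscale : ∀ j < J, ((J - j + n : ℕ) : ℝ) / 6 ≤ ∑ p ∈ P with R j p, (1 : ℝ) / p := by
    intro j hj
    set a := a₀ * c ^ j with ha
    have haa : a₁ ≤ a := le_trans (by omega) (Nat.le_mul_of_pos_right a₀ (hcpos j))
    have hEa : 1 ≤ E * a := Nat.mul_pos hE (by omega)
    refine sum_inv_filter_dyadicPrimes_ge hEa (R j) (fun d hd => H a d haa hd) ?_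
    calc 2 ^ (J - j + n) * (E * a) ≤ 2 ^ (J - j + n) * (2 ^ E * a) :=
          Nat.mul_le_mul_left _ (Nat.mul_le_mul_right _ Nat.lt_two_pow_self.le)
      _ = 2 ^ (J - j + (E + n)) * a := by ring
      _ ≤ c ^ (J - j + (E + n)) * a := Nat.mul_le_mul_right _ (Nat.pow_le_pow_left hc _)
      _ = a₀ * c ^ (J - j + (E + n) + j) := by rw [ha, pow_add _ _ j]; ring
      _ = w := by rw [hw]; congr 2; omega
  have hbad := sum_sum_powerset_card_filter_lt_le P hP1 R K n J hn hscale
  rw [← hF] at hbad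
  have hlarge := hC w (by omega) (by omega)
  rw [← hP, ← hF] at hlarge
  have htotal : F ≤ ∑ S ∈ P.powerset with ∏ p ∈ S, p ≤ 2 ^ (8 * w) ∧
      ∀ j < J, K ≤ (S.filter (R j)).card, ∏ p ∈ S, (1 : ℝ) / p + F / 4 + F / 4 := by
    have h1 : F = ∑ S ∈ P.powerset, ∏ p ∈ S, (1 : ℝ) / p := Finset.prod_one_add P
    calc F = ∑ S ∈ P.powerset, ∏ p ∈ S, (1 : ℝ) / p := h1
      _ ≤ ∑ S ∈ P.powerset with ∏ p ∈ S, p ≤ 2 ^ (8 * w) ∧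
            ∀ j < J, K ≤ (S.filter (R j)).card, ∏ p ∈ S, (1 : ℝ) / p +
          ∑ S ∈ P.powerset with ¬ ∏ p ∈ S, p ≤ 2 ^ (8 * w), ∏ p ∈ S, (1 : ℝ) / p +
          ∑ j ∈ Finset.range J, ∑ S ∈ P.powerset with (S.filter (R j)).card < K,
            ∏ p ∈ S, (1 : ℝ) / p := by
          simp only [Finset.sum_filter]
          rw [Finset.sum_comm, ← Finset.sum_add_distrib, ← Finset.sum_add_distrib]
          refine Finset.sum_le_sum fun S _ => ?_
          have h0 : (0 : ℝ) ≤ ∏ p ∈ S, (1 : ℝ) / p := Finset.prod_nonneg fun p _ => by positivity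
          have h3 : 0 ≤ ∑ j ∈ Finset.range J,
              if (S.filter (R j)).card < K then ∏ p ∈ S, (1 : ℝ) / p else 0 :=
            Finset.sum_nonneg fun j _ => by split_ifs <;> simp only [h0, le_refl]
          by_cases hA : ∏ p ∈ S, p ≤ 2 ^ (8 * w)
          · by_cases hB : ∀ j < J, K ≤ (S.filter (R j)).card
            · rw [if_pos ⟨hA, hB⟩, if_neg (not_not.2 hA)]
              linarith
            · rw [if_neg fun h => hB h.2, if_neg (not_not.2 hA)]
              push Not at hB
              obtain ⟨j, hj, hK⟩ := hB
              have h4 := Finset.single_le_sum (s := Finset.range J)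
                (f := fun j => if (S.filter (R j)).card < K then ∏ p ∈ S, (1 : ℝ) / p else 0)
                (fun j _ => by
                  split_ifs <;> simp only [h0, le_refl])
                (Finset.mem_range.2 hj)
              rw [if_pos hK] at h4
              linarith
          · rw [if_neg fun h => hA h.1, if_pos hA]
            linarith
      _ ≤ _ := by gcongr
  have h1 := mul_log_two_le_prod_dyadicPrimes w
  rw [← hP, ← hF] at h1
  linarith

theorem totient_two_pow_mul_prod (k : ℕ) (S : Finset ℕ) (hS : ∀ p ∈ S, p.Prime ∧ 2 < p) :
    Nat.totient (2 ^ (k + 1) * ∏ p ∈ S, p) = 2 ^ k * ∏ p ∈ S, (p - 1) := by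
  induction S using Finset.induction_on with
  | empty =>
    rw [Finset.prod_empty, Finset.prod_empty, mul_one, mul_one,
      Nat.totient_prime_pow_succ Nat.prime_two]
    norm_num
  | insert p S hp ih =>
    have hS' : ∀ q ∈ S, q.Prime ∧ 2 < q := fun q hq => hS q (Finset.mem_insert_of_mem hq)
    obtain ⟨hpp, hp2⟩ := hS p (Finset.mem_insert_self p S)
    have hcop : Nat.Coprime p (2 ^ (k + 1) * ∏ q ∈ S, q) := by
      refine Nat.Coprime.mul_right ?_ (Nat.Coprime.prod_right fun q hq => ?_)
      · exact ((Nat.coprime_primes hpp Nat.prime_two).2 hp2.ne').pow_right _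
      · exact (Nat.coprime_primes hpp (hS' q hq).1).2 fun h => hp (h ▸ hq)
    rw [Finset.prod_insert hp, Finset.prod_insert hp, Nat.mul_left_comm,
      Nat.totient_mul hcop, ih hS', Nat.totient_prime hpp]
    ring

theorem exists_uDense_dvd_totient {c a₀ J : ℕ} (hc : 2 ≤ c) (hJ : 1 ≤ J)
    (S : Finset ℕ) (hS : ∀ p ∈ S, p.Prime ∧ 2 < p)
    (hgood : ∀ j < J,
      5 * c ^ 2 ≤ (S.filter fun p => PredHasPrime (a₀ * c ^ j) (c * (a₀ * c ^ j)) p).card) :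
    ∃ D, UDense D 2 ∧ D ∣ Nat.totient (2 ^ (c * a₀ + 1) * ∏ p ∈ S, p) ∧
      2 ^ (5 * (a₀ * c ^ J)) ≤ D := by
  set a : ℕ → ℕ := fun j => a₀ * c ^ j with ha
  have hsucc : ∀ j, a (j + 1) = c * a j := fun j => by simp only [ha]; ring
  have hmono : Monotone a := monotone_nat_of_le_succ fun j => by
    rw [hsucc]; exact Nat.le_mul_of_pos_left _ (by omega)
  set q : ℕ → ℕ → ℕ := fun j p =>
    if h : PredHasPrime (a j) (c * a j) p then h.choose else 1 with hq
  have hqspec : ∀ j p, PredHasPrime (a j) (c * a j) p →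
      q j p ∈ dyadicPrimes (a j) (c * a j) ∧ q j p ∣ p - 1 := by
    intro j p h
    simp only [hq, dif_pos h]
    exact h.choose_spec
  have hqone : ∀ j p, ¬ PredHasPrime (a j) (c * a j) p → q j p = 1 := fun j p h => dif_neg h
  have hqpos : ∀ j p, 1 ≤ q j p := by
    intro j p
    by_cases h : PredHasPrime (a j) (c * a j) p
    · exact (mem_dyadicPrimes.1 (hqspec j p h).1).2.one_le
    · rw [hqone j p h]
  have hqle : ∀ j p, q j p ≤ 2 ^ (c * a j) := by
    intro j p
    by_cases h : PredHasPrime (a j) (c * a j) p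
    · exact (mem_dyadicPrimes.1 (hqspec j p h).1).1.2
    · rw [hqone j p h]; exact Nat.one_le_two_pow
  have hqdvd : ∀ j p, q j p ∣ p - 1 := by
    intro j p
    by_cases h : PredHasPrime (a j) (c * a j) p
    · exact (hqspec j p h).2
    · rw [hqone j p h]; exact one_dvd _
  have hqcop_lt : ∀ i j p, i < j → Nat.Coprime (q i p) (q j p) := by
    intro i j p hij
    by_cases hi : PredHasPrime (a i) (c * a i) p
    · by_cases hj : PredHasPrime (a j) (c * a j) p
      · obtain ⟨⟨_, h1⟩, h2⟩ := mem_dyadicPrimes.1 (hqspec i p hi).1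
        obtain ⟨⟨h3, _⟩, h4⟩ := mem_dyadicPrimes.1 (hqspec j p hj).1
        refine (Nat.coprime_primes h2 h4).2 (ne_of_lt ?_)
        refine (h1.trans ?_).trans_lt h3
        rw [← hsucc]
        exact Nat.pow_le_pow_right (by norm_num) (hmono hij)
      · rw [hqone j p hj]; exact Nat.coprime_one_right _
    · rw [hqone i p hi]; exact Nat.coprime_one_left _
  have hprod : ∀ p, ∏ j ∈ Finset.range J, q j p ∣ p - 1 := fun p =>
    Finset.prod_dvd_of_isRelPrime (fun i _ j _ hij => by
      rcases lt_or_gt_of_ne hij with h | h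
      · exact Nat.coprime_iff_isRelPrime.1 (hqcop_lt i j p h)
      · exact (Nat.coprime_iff_isRelPrime.1 (hqcop_lt j i p h)).symm) fun j _ => hqdvd j p
  have hbig : ∀ j < J, 2 ^ (5 * (c * a (j + 1))) ≤ ∏ p ∈ S, q j p := by
    intro j hj
    set T := S.filter fun p => PredHasPrime (a j) (c * a j) p with hT
    calc 2 ^ (5 * (c * a (j + 1))) = (2 ^ a j) ^ (5 * c ^ 2) := by
          rw [hsucc, ← pow_mul]; congr 1; ring
      _ ≤ (2 ^ a j) ^ T.card := Nat.pow_le_pow_right (by positivity) (hgood j hj)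
      _ = ∏ _p ∈ T, 2 ^ a j := by rw [Finset.prod_const]
      _ ≤ ∏ p ∈ T, q j p := Finset.prod_le_prod' fun p hp =>
          (mem_dyadicPrimes.1 (hqspec j p (Finset.mem_filter.1 hp).2).1).1.1.le
      _ ≤ ∏ p ∈ S, q j p :=
          Finset.prod_le_prod_of_subset_of_one_le' (Finset.filter_subset _ _) fun p _ _ => hqpos j p
  set D : ℕ → ℕ := fun j => 2 ^ (c * a₀) * ∏ i ∈ Finset.range j, ∏ p ∈ S, q i p with hD
  have hDsucc : ∀ j, D (j + 1) = D j * ∏ p ∈ S, q j p := fun j => by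
    simp only [hD, Finset.prod_range_succ, mul_assoc]
  have hDpos : ∀ j, 1 ≤ D j := fun j => Nat.mul_pos (by positivity)
    (Finset.prod_pos fun i _ => Finset.prod_pos fun p _ => hqpos i p)
  have hDbig : ∀ j < J, 2 ^ (5 * (c * a (j + 1))) ≤ D (j + 1) := fun j hj => by
    rw [hDsucc]
    exact (hbig j hj).trans (Nat.le_mul_of_pos_left _ (hDpos j))
  have hind : ∀ j ≤ J, UDense (D j) 2 ∧ 2 ^ (c * a j) ≤ D j := by
    intro j
    induction j with
    | zero =>
      intro _
      simp only [hD, ha, Finset.range_zero, Finset.prod_empty, mul_one, pow_zero]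
      exact ⟨uDense_two_pow _, le_rfl⟩
    | succ j ih =>
      intro hj
      obtain ⟨h1, h2⟩ := ih (by omega)
      refine ⟨?_, le_trans ?_ (hDbig j (by omega))⟩
      · rw [hDsucc]
        exact h1.mul_prod S _ fun p _ => ⟨hqpos j p, by linarith [hqle j p]⟩
      · exact Nat.pow_le_pow_right (by norm_num) (by omega)
  refine ⟨D J, (hind J le_rfl).1, ?_, ?_⟩
  · rw [totient_two_pow_mul_prod _ S hS]
    simp only [hD]
    rw [Finset.prod_comm]
    exact Nat.mul_dvd_mul_left _ (Finset.prod_dvd_prod_of_dvd _ _ fun p _ => hprod p)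
  · obtain ⟨j, rfl⟩ : ∃ j, J = j + 1 := ⟨J - 1, by omega⟩
    refine le_trans (Nat.pow_le_pow_right (by norm_num) ?_) (hDbig j (by omega))
    exact Nat.mul_le_mul_left _ (Nat.le_mul_of_pos_left _ (by omega))

theorem eventually_div_log_le_card_primes_gt :
    ∀ᶠ y : ℝ in atTop, ∀ z : ℕ, (z : ℝ) ≤ y ^ (4 / 5 : ℝ) →
      y / (4 * Real.log y) ≤
        (((Finset.Icc 1 ⌊y⌋₊).filter fun p => p.Prime ∧ z < p).card : ℝ) := by
  have hlog : ∀ᶠ y : ℝ in atTop, Real.log y ≤ y ^ (1 / 5 : ℝ) / 100 := by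
    have h := (isLittleO_log_rpow_atTop (show (0 : ℝ) < 1 / 5 by norm_num)).def
      (show (0 : ℝ) < 1 / 100 by norm_num)
    filter_upwards [h, eventually_ge_atTop 1] with y hy hy1
    rw [Real.norm_of_nonneg (Real.log_nonneg hy1),
      Real.norm_of_nonneg (by positivity)] at hy
    linarith
  filter_upwards [hlog, eventually_ge_atTop 100] with y hy hy1 z hz
  have hypos : (0 : ℝ) < y := by linarith
  have hlogpos : 0 < Real.log y := Real.log_pos (by linarith)
  have hpi := Chebyshev.pi_ge' (x := y) (by linarith)
  have hcard : ((Nat.primeCounting ⌊y⌋₊ : ℕ) : ℝ) ≤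
      (((Finset.Icc 1 ⌊y⌋₊).filter fun p => p.Prime ∧ z < p).card : ℝ) + z := by
    have h : Nat.primeCounting ⌊y⌋₊ ≤
        ((Finset.Icc 1 ⌊y⌋₊).filter fun p => p.Prime ∧ z < p).card + z := by
      rw [Nat.primeCounting, Nat.primeCounting', Nat.count_eq_card_filter_range]
      calc _ ≤ (((Finset.Icc 1 ⌊y⌋₊).filter fun p => p.Prime ∧ z < p) ∪ Finset.Icc 1 z).card := by
            refine Finset.card_le_card fun p hp => ?_
            simp only [Finset.mem_filter, Finset.mem_range, Finset.mem_union,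
              Finset.mem_Icc] at hp ⊢
            have := hp.2.one_le
            rcases le_or_gt p z with h | h
            · exact Or.inr ⟨this, h⟩
            · exact Or.inl ⟨⟨this, by omega⟩, hp.2, h⟩
        _ ≤ _ := (Finset.card_union_le _ _).trans (by simp)
    exact_mod_cast h
  have hzlog : z * Real.log y ≤ y / 100 := by
    calc z * Real.log y ≤ y ^ (4 / 5 : ℝ) * (y ^ (1 / 5 : ℝ) / 100) :=
          mul_le_mul hz hy hlogpos.le (by positivity)
      _ = y / 100 := by
          rw [← mul_div_assoc, ← Real.rpow_add hypos]; norm_num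
  have hlog2 : Real.log (y + 2) ≤ y / 50 + 1 := by
    have h1 : y ^ (1 / 5 : ℝ) ≤ y := by
      calc y ^ (1 / 5 : ℝ) ≤ y ^ (1 : ℝ) :=
            Real.rpow_le_rpow_of_exponent_le (by linarith) (by norm_num)
        _ = y := Real.rpow_one y
    have h2 : Real.log (y + 2) ≤ Real.log y + 1 := by
      have h3 : Real.log ((y + 2) / y) ≤ (y + 2) / y - 1 :=
        Real.log_le_sub_one_of_pos (by positivity)
      have h4 : (y + 2) / y - 1 ≤ 1 := by
        rw [sub_le_iff_le_add, div_le_iff₀ hypos]; linarith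
      rw [Real.log_div (by positivity) hypos.ne'] at h3
      linarith
    linarith
  have hl2 := Real.log_two_gt_d9
  have hkey : y / (4 * Real.log y) ≤
      ((y - 1) * Real.log 2 - Real.log (y + 2)) / Real.log y - z := by
    rw [div_le_iff₀ (by positivity)]
    have : (((y - 1) * Real.log 2 - Real.log (y + 2)) / Real.log y - z) * (4 * Real.log y) =
        4 * ((y - 1) * Real.log 2 - Real.log (y + 2)) - 4 * (z * Real.log y) := by
      field_simp
    rw [this]
    nlinarith
  linarith

theorem card_primeFactors_filter_gt_le {n Z k : ℕ} (hZ : 1 ≤ Z) (hn : 0 < n)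
    (hnk : n ≤ Z ^ k) : (n.primeFactors.filter fun p => Z < p).card ≤ k := by
  set Q := n.primeFactors.filter fun p => Z < p with hQ
  by_contra! h
  have h1 : (Z + 1) ^ (k + 1) ≤ n := by
    calc (Z + 1) ^ (k + 1) ≤ (Z + 1) ^ Q.card := Nat.pow_le_pow_right (by omega) h
      _ = ∏ _p ∈ Q, (Z + 1) := by rw [Finset.prod_const]
      _ ≤ ∏ p ∈ Q, p := Finset.prod_le_prod' fun p hp => (Finset.mem_filter.1 hp).2
      _ ≤ n := Nat.le_of_dvd hn ((Finset.prod_dvd_prod_of_subset _ _ _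
          (Finset.filter_subset _ _)).trans (Nat.prod_primeFactors_dvd n))
  have h2 : Z ^ k < (Z + 1) ^ (k + 1) :=
    calc Z ^ k ≤ Z ^ (k + 1) := Nat.pow_le_pow_right hZ (by omega)
      _ < (Z + 1) ^ (k + 1) := Nat.pow_lt_pow_left (by omega) (by omega)
  omega

/-- The number of ways to write `n` as `2 ^ L` times a product of distinct primes times `r + 1` primes
exceeding `Z`. -/
theorem card_le_pow_of_mul_prod_eq {L Z r k n : ℕ} (hZ : 1 ≤ Z) (hn : 0 < n) (hnk : n ≤ Z ^ k)
    (F : Finset (Σ _ : Finset ℕ × (Fin r → ℕ), ℕ))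
    (hF : ∀ x ∈ F, (∀ p ∈ x.1.1, p.Prime) ∧ (∀ i, (x.1.2 i).Prime ∧ Z < x.1.2 i) ∧
      (x.2.Prime ∧ Z < x.2) ∧ 2 ^ L * (∏ p ∈ x.1.1, p) * (∏ i, x.1.2 i) * x.2 = n) :
    F.card ≤ k ^ (r + 1) := by
  set Q := n.primeFactors.filter fun p => Z < p with hQ
  have hQk : Q.card ≤ k := card_primeFactors_filter_gt_le hZ hn hnk
  have hmem : ∀ p, p.Prime → Z < p → p ∣ n → p ∈ Q := fun p hp hZp hpn =>
    Finset.mem_filter.2 ⟨Nat.mem_primeFactors.2 ⟨hp, hpn, hn.ne'⟩, hZp⟩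
  calc F.card ≤ ((Fintype.piFinset fun _ : Fin r => Q) ×ˢ Q).card := by
        refine Finset.card_le_card_of_injOn (fun x => (x.1.2, x.2)) ?_ ?_
        · intro x hx
          obtain ⟨-, h2, h3, h4⟩ := hF x hx
          refine Finset.mem_coe.2 (Finset.mem_product.2 ⟨Fintype.mem_piFinset.2 fun i => ?_, ?_⟩)
          · refine hmem _ (h2 i).1 (h2 i).2 ?_
            rw [← h4]
            exact Dvd.dvd.mul_right (Dvd.dvd.mul_left
              (Finset.dvd_prod_of_mem _ (Finset.mem_univ i)) _) _
          · exact hmem _ h3.1 h3.2 (h4 ▸ Dvd.intro_left _ rfl)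
        · rintro ⟨⟨S, v⟩, p⟩ hx ⟨⟨S', v'⟩, p'⟩ hx' heq
          obtain ⟨h1, h2, h3, h4⟩ := hF _ hx
          obtain ⟨h1', -, -, h4'⟩ := hF _ hx'
          simp only [Prod.mk.injEq] at heq
          obtain ⟨rfl, rfl⟩ := heq
          dsimp only at h1 h2 h3 h4 h1' h4'
          have hS : ∏ q ∈ S, q = ∏ q ∈ S', q := by
            rw [← h4'] at h4
            have := Nat.eq_of_mul_eq_mul_right h3.1.pos h4
            have := Nat.eq_of_mul_eq_mul_right
              (Finset.prod_pos fun i _ => (h2 i).1.pos) this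
            exact Nat.eq_of_mul_eq_mul_left (by positivity) this
          have hSS : S = S' := by
            rw [← Nat.primeFactors_prod h1, hS, Nat.primeFactors_prod h1']
          rw [hSS]
    _ = Q.card ^ (r + 1) := by
        rw [Finset.card_product, Fintype.card_piFinset_const, pow_succ]
    _ ≤ k ^ (r + 1) := Nat.pow_le_pow_left hQk _

theorem mul_sum_le_pow_mul_card (A : ℕ → Prop) {L Z r k : ℕ} {x δ : ℝ} (hZ : 1 ≤ Z) (hx : 0 ≤ x)
    (hxk : ⌊x⌋₊ ≤ Z ^ k) (T : Finset (Finset ℕ)) (P : Finset ℕ)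
    (hT : ∀ S ∈ T, ∀ p ∈ S, p.Prime) (hP : ∀ p ∈ P, p.Prime ∧ Z < p)
    (hcount : ∀ S ∈ T, ∀ v ∈ Fintype.piFinset fun _ : Fin r => P,
      δ * (x / (2 ^ L * (∏ p ∈ S, p) * (∏ i, v i) : ℕ)) ≤
        (((Finset.Icc 1 ⌊x / (2 ^ L * (∏ p ∈ S, p) * (∏ i, v i) : ℕ)⌋₊).filter
          fun p => p.Prime ∧ Z < p).card : ℝ))
    (hA : ∀ S ∈ T, ∀ v ∈ Fintype.piFinset fun _ : Fin r => P, ∀ p : ℕ, p.Prime → Z < p →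
      2 ^ L * (∏ p ∈ S, p) * (∏ i, v i) * p ≤ ⌊x⌋₊ →
      A (2 ^ L * (∏ p ∈ S, p) * (∏ i, v i) * p)) :
    δ * x / 2 ^ L * (∑ S ∈ T, ∏ p ∈ S, (1 : ℝ) / p) * (∑ p ∈ P, (1 : ℝ) / p) ^ r ≤
      k ^ (r + 1) * (((Finset.Icc 1 ⌊x⌋₊).filter A).card : ℝ) := by
  set N : Finset ℕ × (Fin r → ℕ) → ℕ := fun y => 2 ^ L * (∏ p ∈ y.1, p) * (∏ i, y.2 i) with hN
  set U := T ×ˢ (Fintype.piFinset fun _ : Fin r => P) with hU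
  set F : Finset (Σ _ : Finset ℕ × (Fin r → ℕ), ℕ) := U.sigma fun y =>
    (Finset.Icc 1 ⌊x / (N y : ℕ)⌋₊).filter fun p => p.Prime ∧ Z < p with hF
  have hUmem : ∀ y ∈ U, y.1 ∈ T ∧ y.2 ∈ Fintype.piFinset fun _ : Fin r => P :=
    fun y hy => Finset.mem_product.1 hy
  have hNpos : ∀ y ∈ U, 0 < N y := fun y hy =>
    Nat.mul_pos (Nat.mul_pos (by positivity) (Finset.prod_pos fun p hp =>
      (hT _ (hUmem y hy).1 p hp).pos)) (Finset.prod_pos fun i _ =>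
      (hP _ (Fintype.mem_piFinset.1 (hUmem y hy).2 i)).1.pos)
  have hle : ∀ y ∈ U, ∀ p, p ∈ Finset.Icc 1 ⌊x / (N y : ℕ)⌋₊ → N y * p ≤ ⌊x⌋₊ := by
    intro y hy p hp
    have h := (Finset.mem_Icc.1 hp).2
    have hpos : (0 : ℝ) < (N y : ℝ) := by exact_mod_cast hNpos y hy
    refine Nat.le_floor ?_
    have h1 : (p : ℝ) ≤ x / N y := (Nat.cast_le.2 h).trans (Nat.floor_le (by positivity))
    rw [le_div_iff₀ hpos] at h1
    push_cast
    linarith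
  have hcardF : F.card ≤ k ^ (r + 1) * ((Finset.Icc 1 ⌊x⌋₊).filter A).card := by
    refine Finset.card_le_mul_card_image_of_maps_to (f := fun z => N z.1 * z.2) ?_ _ ?_
    · rintro ⟨y, p⟩ hz
      obtain ⟨hy, hp⟩ := Finset.mem_sigma.1 hz
      obtain ⟨hp1, hp2, hp3⟩ := Finset.mem_filter.1 hp
      have h := hle y hy p hp1
      refine Finset.mem_filter.2 ⟨Finset.mem_Icc.2 ⟨Nat.mul_pos (hNpos y hy) hp2.pos, h⟩, ?_⟩
      exact hA _ (hUmem y hy).1 _ (hUmem y hy).2 p hp2 hp3 h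
    · intro n hn
      obtain ⟨h1, h2⟩ := Finset.mem_Icc.1 (Finset.mem_filter.1 hn).1
      refine card_le_pow_of_mul_prod_eq (L := L) hZ h1 (h2.trans hxk) _ ?_
      rintro ⟨y, p⟩ hz
      obtain ⟨hz, heq⟩ := Finset.mem_filter.1 hz
      obtain ⟨hy, hp⟩ := Finset.mem_sigma.1 hz
      exact ⟨hT _ (hUmem y hy).1, fun i => hP _ (Fintype.mem_piFinset.1 (hUmem y hy).2 i),
        (Finset.mem_filter.1 hp).2, heq⟩
  have hsum : δ * x / 2 ^ L * (∑ S ∈ T, ∏ p ∈ S, (1 : ℝ) / p) * (∑ p ∈ P, (1 : ℝ) / p) ^ r =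
      ∑ y ∈ U, δ * (x / (N y : ℕ)) := by
    rw [hU, Finset.sum_product, Finset.sum_pow', mul_assoc, Finset.sum_mul_sum, Finset.mul_sum]
    refine Finset.sum_congr rfl fun S _ => ?_
    rw [Finset.mul_sum]
    refine Finset.sum_congr rfl fun v _ => ?_
    simp only [hN, Finset.prod_div_distrib, Finset.prod_const_one]
    push_cast
    simp only [div_eq_mul_inv, mul_inv, one_mul]
    ring
  calc _ = ∑ y ∈ U, δ * (x / (N y : ℕ)) := hsum
    _ ≤ ∑ y ∈ U, (((Finset.Icc 1 ⌊x / (N y : ℕ)⌋₊).filter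
          fun p => p.Prime ∧ Z < p).card : ℝ) := Finset.sum_le_sum fun y hy =>
        hcount _ (hUmem y hy).1 _ (hUmem y hy).2
    _ = (F.card : ℝ) := by rw [hF, Finset.card_sigma]; push_cast; rfl
    _ ≤ _ := by exact_mod_cast hcardF

theorem exists_scales {c a₀ : ℕ} (hc : 2 ≤ c) (ha₀ : 1 ≤ a₀) (J₀ L t₀ : ℕ) :
    ∃ l₀ : ℕ, ∀ l ≥ l₀, ∃ J t w : ℕ, w = a₀ * c ^ (J + J₀) ∧ 1 ≤ J ∧ t₀ ≤ t ∧
      l + 1 ≤ 8 * (64 * c ^ (J₀ + 1)) * t ∧ t ≤ a₀ * c ^ J ∧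
      L + 8 * w + 5 * t * (64 * c ^ (J₀ + 1)) + 5 * t ≤ l ∧ l ≤ 64 * c * w := by
  set r := 64 * c ^ (J₀ + 1) with hr
  have hr64 : 64 ≤ r := Nat.le_mul_of_pos_right _ (by positivity)
  refine ⟨8 * r * t₀ + 64 * a₀ * c ^ (J₀ + 1) + 20 * L + 200 * r, fun l hl => ?_⟩
  set s := Nat.log c (l / (64 * a₀)) with hs
  have hle : c ^ (J₀ + 1) ≤ l / (64 * a₀) := by
    rw [Nat.le_div_iff_mul_le (by positivity)]
    nlinarith
  have hpos : l / (64 * a₀) ≠ 0 := by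
    have : 0 < c ^ (J₀ + 1) := by positivity
    omega
  have hsJ : J₀ + 1 ≤ s := Nat.le_log_of_pow_le (by omega) hle
  obtain ⟨J, hJ⟩ : ∃ J, s = J + J₀ := ⟨s - J₀, by omega⟩
  have h1 : c ^ s ≤ l / (64 * a₀) := Nat.pow_log_le_self c hpos
  have h2 : l / (64 * a₀) < c ^ (s + 1) := Nat.lt_pow_succ_log_self (by omega) _
  rw [Nat.le_div_iff_mul_le (by positivity)] at h1
  rw [Nat.div_lt_iff_lt_mul (by positivity)] at h2
  have hdiv1 : l / (8 * r) * (8 * r) ≤ l := Nat.div_mul_le_self _ _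
  have hdiv2 : l < (l / (8 * r) + 1) * (8 * r) := by
    rw [add_mul, one_mul]; exact Nat.lt_div_mul_add (by omega)
  set u := l / (8 * r) with hu
  have hw1 : 64 * (a₀ * c ^ (J + J₀)) ≤ l := by rw [hJ] at h1; linarith
  have hw2 : l ≤ 64 * c * (a₀ * c ^ (J + J₀)) := by
    rw [hJ, pow_succ] at h2; linarith
  have hJ1 : 1 ≤ J := by omega
  refine ⟨J, u + 1, a₀ * c ^ (J + J₀), rfl, hJ1, ?_, by linarith, ?_, ?_, hw2⟩
  · have : t₀ ≤ u := by
      rw [hu, Nat.le_div_iff_mul_le (by omega), Nat.mul_comm]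
      omega
    omega
  · have h3 : 2 ≤ a₀ * c ^ J := by
      calc 2 ≤ c := hc
        _ = c ^ 1 := (pow_one c).symm
        _ ≤ c ^ J := Nat.pow_le_pow_right (by omega) hJ1
        _ ≤ a₀ * c ^ J := Nat.le_mul_of_pos_left _ ha₀
    have h4 : u * (8 * r) ≤ (a₀ * c ^ J) * r := by
      calc u * (8 * r) ≤ l := hdiv1
        _ ≤ 64 * c * (a₀ * c ^ (J + J₀)) := hw2
        _ = (a₀ * c ^ J) * r := by rw [hr]; ring
    have h5 : 8 * u ≤ a₀ * c ^ J := by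
      refine Nat.le_of_mul_le_mul_right (c := r) ?_ (by omega)
      linarith
    omega
  · have h6 : u * 64 ≤ u * r := Nat.mul_le_mul_left _ hr64
    have h7 : 5 * (u + 1) * r = 5 * (u * r) + 5 * r := by ring
    have h8 : u * (8 * r) = 8 * (u * r) := by ring
    rw [h7]
    rw [h8] at hdiv1
    omega

theorem uDense_totient_of_scales {c a₀ J t r : ℕ} (hc : 2 ≤ c) (hJ : 1 ≤ J)
    (ht : t ≤ a₀ * c ^ J) (S : Finset ℕ) (hS : ∀ p ∈ S, p.Prime ∧ 2 < p)
    (hgood : ∀ j < J,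
      5 * c ^ 2 ≤ (S.filter fun p => PredHasPrime (a₀ * c ^ j) (c * (a₀ * c ^ j)) p).card)
    (v : Fin r → ℕ) (hv : ∀ i, v i ∈ dyadicPrimes (4 * t) (5 * t)) {n : ℕ} (hn : 0 < n)
    (hdvd : 2 ^ (c * a₀ + 1) * (∏ p ∈ S, p) * (∏ i, v i) ∣ n) (hle : n ≤ 2 ^ (8 * r * t)) :
    UDense n.totient 2 := by
  obtain ⟨D, hD, hDN, hDle⟩ := exists_uDense_dvd_totient hc hJ S hS hgood
  have hD5 : 2 ^ (5 * t) ≤ D := (Nat.pow_le_pow_right (by norm_num) (by omega)).trans hDle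
  have hD0 : 0 < D := lt_of_lt_of_le (by positivity) hD5
  obtain ⟨D', hD', hdvd', hle'⟩ := exists_uDense_dvd_totient_mul_prod (B := 2 ^ (4 * t)) v
    hD hDN hD0 fun i => by
      obtain ⟨⟨h1, h2⟩, h3⟩ := mem_dyadicPrimes.1 (hv i)
      exact ⟨h3, h1, h2.trans hD5⟩
  refine uDense_totient_of_dvd hD' hdvd' hdvd hn (hle.trans ?_)
  have h : (2 ^ (4 * t)) ^ r ≤ D' := (Nat.le_mul_of_pos_left _ hD0).trans hle'
  calc 2 ^ (8 * r * t) = (2 ^ (4 * t)) ^ r * (2 ^ (4 * t)) ^ r := by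
        rw [← pow_mul, ← pow_add]; congr 1; ring
    _ ≤ D' * D' := Nat.mul_le_mul h h

theorem exists_one_div_ten_le_sum_inv_dyadicPrimes :
    ∃ t₀ : ℕ, ∀ t ≥ t₀, (1 : ℝ) / 10 ≤ ∑ p ∈ dyadicPrimes (4 * t) (5 * t), (1 : ℝ) / p := by
  obtain ⟨C, hC⟩ := exists_sum_inv_dyadicPrimes_ge
  refine ⟨2 * C + 1, fun t ht => ?_⟩
  have h := hC (4 * t) (5 * t) (by omega)
  have ht' : (2 : ℝ) * C + 1 ≤ t := by exact_mod_cast ht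
  have hC0 : (0 : ℝ) ≤ C := by positivity
  push_cast at h
  nlinarith

theorem div_log_le_card_primes_gt_of_pow_le {Y : ℝ}
    (hY : ∀ y ≥ Y, ∀ z : ℕ, (z : ℝ) ≤ y ^ (4 / 5 : ℝ) → y / (4 * Real.log y) ≤
        (((Finset.Icc 1 ⌊y⌋₊).filter fun p => p.Prime ∧ z < p).card : ℝ))
    {t N : ℕ} {x : ℝ} (ht : Y ≤ 2 ^ (5 * t)) (ht1 : 1 ≤ t) (hN : 0 < N)
    (hNx : (N : ℝ) * 2 ^ (5 * t) ≤ x) :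
    1 / (4 * Real.log x) * (x / N) ≤
      (((Finset.Icc 1 ⌊x / N⌋₊).filter fun p => p.Prime ∧ 2 ^ (4 * t) < p).card : ℝ) := by
  have hN' : (1 : ℝ) ≤ N := by exact_mod_cast hN
  have hy : (2 : ℝ) ^ (5 * t) ≤ x / N := by
    rw [le_div_iff₀ (by linarith)]; linarith
  have h1 : (1 : ℝ) < 2 ^ (5 * t) := one_lt_pow₀ (by norm_num) (by omega)
  have hxpos : 0 < x := lt_of_lt_of_le (by positivity) hNx
  have hlog : Real.log (x / N) ≤ Real.log x :=
    Real.log_le_log (by linarith) (div_le_self hxpos.le hN')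
  have hlogpos : 0 < Real.log (x / N) := Real.log_pos (by linarith)
  refine le_trans ?_ (hY _ (ht.trans hy) (2 ^ (4 * t)) ?_)
  · rw [one_div_mul_eq_div]
    exact div_le_div_of_nonneg_left (by linarith) (by positivity) (by linarith)
  · calc ((2 ^ (4 * t) : ℕ) : ℝ) = ((2 : ℝ) ^ (5 * t)) ^ (4 / 5 : ℝ) := by
          rw [← Real.rpow_natCast, ← Real.rpow_mul (by norm_num)]
          push_cast
          rw [← Real.rpow_natCast]
          congr 1
          push_cast
          ring
      _ ≤ (x / N) ^ (4 / 5 : ℝ) := Real.rpow_le_rpow (by positivity) hy (by norm_num)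

theorem stmt_4 : ∃ c : ℝ, 0 < c ∧ ∀ᶠ x : ℝ in atTop,
    c * x ≤ (((Finset.Icc 1 ⌊x⌋₊).filter (fun n => UDense (Nat.totient n) 2)).card : ℝ) := by
  obtain ⟨c, a₀, hc, ha₀, hF⟩ := exists_sum_good_subsets_ge
  obtain ⟨J₀, hJ₀⟩ := hF (5 * c ^ 2)
  obtain ⟨Y, hY⟩ := eventually_atTop.1 eventually_div_log_le_card_primes_gt
  obtain ⟨t₁, ht₁⟩ := exists_one_div_ten_le_sum_inv_dyadicPrimes
  set L := c * a₀ + 1 with hL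
  obtain ⟨l₀, hl₀⟩ := exists_scales hc ha₀ J₀ L (t₁ + ⌈Y⌉₊ + 1)
  set r := 64 * c ^ (J₀ + 1) with hr
  have hcpos : (0 : ℝ) < c := by exact_mod_cast (by omega : 0 < c)
  have hrpos : (0 : ℝ) < r := by rw [hr]; push_cast; positivity
  refine ⟨1 / (3072 * c) / 2 ^ L * (1 / 10) ^ r / (2 * r) ^ (r + 1), by positivity, ?_⟩
  filter_upwards [eventually_ge_atTop ((2 : ℝ) ^ (l₀ + 1))] with x hx
  have hx2 : (2 : ℝ) ≤ x := le_trans (by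
    calc (2 : ℝ) = 2 ^ 1 := (pow_one _).symm
      _ ≤ 2 ^ (l₀ + 1) := pow_le_pow_right₀ (by norm_num) (by omega)) hx
  have hxf : 2 ^ (l₀ + 1) ≤ ⌊x⌋₊ := Nat.le_floor (by push_cast; exact hx)
  have hf0 : ⌊x⌋₊ ≠ 0 := by
    have : 0 < 2 ^ (l₀ + 1) := by positivity
    omega
  set l := Nat.log 2 ⌊x⌋₊ with hl
  have hl1 : 2 ^ l ≤ ⌊x⌋₊ := Nat.pow_log_le_self 2 hf0
  have hl2 : ⌊x⌋₊ < 2 ^ (l + 1) := Nat.lt_pow_succ_log_self (by norm_num) _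
  have hll : l₀ + 1 ≤ l := Nat.le_log_of_pow_le (by norm_num) hxf
  obtain ⟨J, t, w, hw, hJ, ht, hlt, htJ, hsize, hlw⟩ := hl₀ l (by omega)
  have hxl : (2 : ℝ) ^ l ≤ x := le_trans (by exact_mod_cast hl1) (Nat.floor_le (by linarith))
  have hfk : ⌊x⌋₊ ≤ 2 ^ (8 * r * t) :=
    hl2.le.trans (Nat.pow_le_pow_right (by norm_num) hlt)
  have hlogx : Real.log x ≤ 128 * c * w * Real.log 2 := by
    have h1 : x ≤ 2 ^ (l + 1) := (Nat.lt_floor_add_one x).le.trans (by exact_mod_cast hl2)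
    have h2 : Real.log x ≤ (l + 1 : ℕ) * Real.log 2 := by
      rw [← Real.log_pow]; exact Real.log_le_log (by linarith) h1
    have h3 : ((l + 1 : ℕ) : ℝ) ≤ 128 * c * w := by
      exact_mod_cast (by nlinarith : l + 1 ≤ 128 * c * w)
    exact h2.trans (mul_le_mul_of_nonneg_right h3 (Real.log_nonneg (by norm_num)))
  have hlogpos : 0 < Real.log x := Real.log_pos (by linarith)
  set T := (dyadicPrimes 1 w).powerset.filter fun S => ∏ p ∈ S, p ≤ 2 ^ (8 * w) ∧ ∀ j < J,
    5 * c ^ 2 ≤ (S.filter fun p => PredHasPrime (a₀ * c ^ j) (c * (a₀ * c ^ j)) p).card with hTdef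
  have hTsum : w * Real.log 2 / 6 ≤ ∑ S ∈ T, ∏ p ∈ S, (1 : ℝ) / p := hJ₀ J w hw
  have hTS : ∀ S ∈ T, ∀ p ∈ S, p.Prime ∧ 2 < p := by
    intro S hS p hp
    obtain ⟨⟨h1, -⟩, h2⟩ :=
      mem_dyadicPrimes.1 (Finset.mem_powerset.1 (Finset.mem_filter.1 hS).1 hp)
    exact ⟨h2, h1⟩
  have hmain := mul_sum_le_pow_mul_card (fun n => UDense (Nat.totient n) 2) (L := L)
    (Z := 2 ^ (4 * t)) (r := r) (k := 2 * r) (x := x) (δ := 1 / (4 * Real.log x))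
    Nat.one_le_two_pow (by linarith) (by
      rw [← pow_mul]; convert hfk using 2; ring) T (dyadicPrimes (4 * t) (5 * t))
    (fun S hS p hp => (hTS S hS p hp).1)
    (fun p hp => ⟨(mem_dyadicPrimes.1 hp).2, (mem_dyadicPrimes.1 hp).1.1⟩)
    (by
      intro S hS v hv
      have hv' := fun i => mem_dyadicPrimes.1 (Fintype.mem_piFinset.1 hv i)
      refine div_log_le_card_primes_gt_of_pow_le hY ?_ (by omega) ?_ ?_
      · calc Y ≤ (⌈Y⌉₊ : ℝ) := Nat.le_ceil Y
          _ ≤ (5 * t : ℕ) := by exact_mod_cast (by omega)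
          _ ≤ 2 ^ (5 * t) := by exact_mod_cast Nat.lt_two_pow_self.le
      · exact Nat.mul_pos (Nat.mul_pos (by positivity) (Finset.prod_pos fun p hp =>
          (hTS S hS p hp).1.pos)) (Finset.prod_pos fun i _ => (hv' i).2.pos)
      · refine le_trans ?_ hxl
        have hvle : ∏ i, v i ≤ 2 ^ (5 * t * r) := by
          calc ∏ i, v i ≤ ∏ _i : Fin r, 2 ^ (5 * t) :=
                Finset.prod_le_prod' fun i _ => (hv' i).1.2
            _ = 2 ^ (5 * t * r) := by rw [Finset.prod_const, ← pow_mul]; simp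
        have hSle := (Finset.mem_filter.1 hS).2.1
        have : 2 ^ L * (∏ p ∈ S, p) * (∏ i, v i) * 2 ^ (5 * t) ≤ 2 ^ l := by
          calc _ ≤ 2 ^ L * 2 ^ (8 * w) * 2 ^ (5 * t * r) * 2 ^ (5 * t) := by gcongr
            _ = 2 ^ (L + 8 * w + 5 * t * r + 5 * t) := by simp only [pow_add]
            _ ≤ 2 ^ l := Nat.pow_le_pow_right (by norm_num) hsize
        exact_mod_cast this)
    (by
      intro S hS v hv p hp hZp hle
      refine uDense_totient_of_scales hc hJ htJ S (hTS S hS) (Finset.mem_filter.1 hS).2.2 v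
        (fun i => Fintype.mem_piFinset.1 hv i) ?_ (Dvd.intro _ rfl) (hle.trans hfk)
      exact Nat.mul_pos (Nat.mul_pos (Nat.mul_pos (by positivity) (Finset.prod_pos fun p hp =>
        (hTS S hS p hp).1.pos)) (Finset.prod_pos fun i _ =>
        (mem_dyadicPrimes.1 (Fintype.mem_piFinset.1 hv i)).2.pos)) hp.pos)
  have hP := ht₁ t (by omega)
  have hδ : 1 / (3072 * (c : ℝ)) ≤ 1 / (4 * Real.log x) * (w * Real.log 2 / 6) := by
    rw [one_div_mul_eq_div, div_le_div_iff₀ (by positivity) (by positivity)]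
    nlinarith
  rw [div_mul_eq_mul_div, div_le_iff₀ (by positivity), mul_comm (Finset.card _ : ℝ)]
  calc 1 / (3072 * (c : ℝ)) / 2 ^ L * (1 / 10) ^ r * x
      ≤ 1 / (4 * Real.log x) * (w * Real.log 2 / 6) / 2 ^ L * (1 / 10) ^ r * x := by gcongr
    _ = 1 / (4 * Real.log x) * x / 2 ^ L * (w * Real.log 2 / 6) * (1 / 10) ^ r := by ring
    _ ≤ 1 / (4 * Real.log x) * x / 2 ^ L * (∑ S ∈ T, ∏ p ∈ S, (1 : ℝ) / p) *
        (∑ p ∈ dyadicPrimes (4 * t) (5 * t), (1 : ℝ) / p) ^ r := by gcongr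
    _ ≤ _ := hmain
    _ = _ := by push_cast; ring
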